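/- Consider n unit-demand agents, m items with capacities k_j ≥ 1, and independent values v_ij ∼ F_ij (Borel distributions on ℝ_{≥0} with finite mean). The expected revenue of every lottery-based mechanism for the multi-agent instance is at most 5 times the supremum of expected revenue over all dominant-strategy incentive compatible, individually rational deterministic mechanisms for the copies instance. -/

import Mathlib

open MeasureTheory

/-- `S` is a matching: each agent `i` appears in at most one pair of `S` and
each item `j` appears in at most `k j` pairs of `S`. -/
def IsMatching (n m : ℕ) (k : Fin m → ℕ) (S : Finset (Fin n × Fin m)) : Prop :=
  (∀ i : Fin n, (S.filter fun e => e.1 = i).card ≤ 1) ∧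
  (∀ j : Fin m, (S.filter fun e => e.2 = j).card ≤ k j)

/-- `matchRank n m k S` is the maximum cardinality of a matching contained
in `S`. -/
noncomputable def matchRank (n m : ℕ) (k : Fin m → ℕ)
    (S : Finset (Fin n × Fin m)) : ℕ :=
  sSup {c : ℕ | ∃ M : Finset (Fin n × Fin m), M ⊆ S ∧ IsMatching n m k M ∧ M.card = c}

/-- The product distribution of the independent values `v i j ∼ F i j` on
valuation matrices. -/
noncomputable def valMeasure {n m : ℕ} (F : Fin n → Fin m → Measure ℝ) :
    Measure (Fin n → Fin m → ℝ) :=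
  Measure.pi fun i => Measure.pi fun j => F i j

/-- The valuation matrix obtained from `v` by changing entry `(i, j)` to `c`. -/
noncomputable def updateEntry {n m : ℕ} (v : Fin n → Fin m → ℝ) (i : Fin n)
    (j : Fin m) (c : ℝ) : Fin n → Fin m → ℝ :=
  Function.update v i (Function.update (v i) j c)

/-- A dominant-strategy IC, IR deterministic mechanism for the copies
instance: `X v` is the feasible set of served pseudo-agents (a matching) and
`pay v (i, j) ≥ 0` is the payment of pseudo-agent `(i, j)`. -/
structure IsCopiesMech (n m : ℕ) (k : Fin m → ℕ)
    (X : (Fin n → Fin m → ℝ) → Finset (Fin n × Fin m))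
    (pay : (Fin n → Fin m → ℝ) → Fin n × Fin m → ℝ) : Prop where
  feas : ∀ v, IsMatching n m k (X v)
  measX : ∀ S : Finset (Fin n × Fin m), MeasurableSet {v | X v = S}
  measPay : ∀ e : Fin n × Fin m, Measurable fun v => pay v e
  pay_nonneg : ∀ v e, 0 ≤ pay v e
  ic : ∀ v : Fin n → Fin m → ℝ, (∀ i j, 0 ≤ v i j) →
    ∀ (i : Fin n) (j : Fin m) (c : ℝ), 0 ≤ c →
      (if (i, j) ∈ X (updateEntry v i j c) then v i j else 0)
          - pay (updateEntry v i j c) (i, j)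
        ≤ (if (i, j) ∈ X v then v i j else 0) - pay v (i, j)
  ir : ∀ v : Fin n → Fin m → ℝ, (∀ i j, 0 ≤ v i j) → ∀ e : Fin n × Fin m,
    0 ≤ (if e ∈ X v then v e.1 e.2 else 0) - pay v e

/-- Expected revenue of a mechanism for the copies instance. -/
noncomputable def copiesRevenue {n m : ℕ} (F : Fin n → Fin m → Measure ℝ)
    (pay : (Fin n → Fin m → ℝ) → Fin n × Fin m → ℝ) : ℝ :=
  ∫ v, ∑ e : Fin n × Fin m, pay v e ∂(valMeasure F)

/-- A lottery over `m` items: allocation probabilities `q` with `q j ≥ 0`,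
`∑ j, q j ≤ 1`, and a price `p ≥ 0`. -/
structure Lottery (m : ℕ) where
  q : Fin m → ℝ
  p : ℝ
  q_nonneg : ∀ j, 0 ≤ q j
  q_sum_le_one : ∑ j, q j ≤ 1
  p_nonneg : 0 ≤ p

/-- The (expected) utility of lottery `ℓ` at valuation `v`. -/
def Lottery.util {m : ℕ} (ℓ : Lottery m) (v : Fin m → ℝ) : ℝ :=
  (∑ j, ℓ.q j * v j) - ℓ.p

/-- A lottery-based mechanism for the multi-agent instance: agent `i` facing
the other agents' values is offered the menu `menu i v` (which does not depend
on `v i`), and purchases the utility-maximizing lottery, whose probability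
vector and price at profile `v` are `q v i` and `p v i`; the purchase
probabilities satisfy the matching feasibility constraint
`∑_{(i,j) ∈ S} q v i j ≤ r S`. -/
structure IsLotteryMech (n m : ℕ) (k : Fin m → ℕ)
    (menu : Fin n → (Fin n → Fin m → ℝ) → Set (Lottery m))
    (q : (Fin n → Fin m → ℝ) → Fin n → Fin m → ℝ)
    (p : (Fin n → Fin m → ℝ) → Fin n → ℝ) : Prop where
  menu_indep : ∀ (i : Fin n) (v w : Fin n → Fin m → ℝ),
    (∀ i', i' ≠ i → v i' = w i') → menu i v = menu i w
  measQ : ∀ i j, Measurable fun v => q v i j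
  measP : ∀ i, Measurable fun v => p v i
  choice : ∀ v : Fin n → Fin m → ℝ, (∀ i j, 0 ≤ v i j) → ∀ i : Fin n,
    (∃ ℓ ∈ menu i v, ℓ.q = q v i ∧ ℓ.p = p v i ∧ 0 ≤ ℓ.util (v i) ∧
      ∀ ℓ' ∈ menu i v, ℓ'.util (v i) ≤ ℓ.util (v i)) ∨
    (q v i = 0 ∧ p v i = 0 ∧ ∀ ℓ ∈ menu i v, ℓ.util (v i) ≤ 0)
  feas : ∀ (v : Fin n → Fin m → ℝ) (S : Finset (Fin n × Fin m)),
    ∑ e ∈ S, q v e.1 e.2 ≤ (matchRank n m k S : ℝ)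

/-- Expected revenue of a lottery-based multi-agent mechanism. -/
noncomputable def lotteryMechRevenue {n m : ℕ} (F : Fin n → Fin m → Measure ℝ)
    (p : (Fin n → Fin m → ℝ) → Fin n → ℝ) : ℝ :=
  ∫ v, ∑ i : Fin n, p v i ∂(valMeasure F)

/-- The largest positive surplus `x j' - ρ j'` among the items `j' ≠ j`, or `0`. -/
noncomputable def altSurplus {m : ℕ} (ρ x : Fin m → ℝ) (j : Fin m) : ℝ :=
  ((Finset.univ.erase j).sup fun j' => (x j' - ρ j').toNNReal : NNReal)

/-- The valuations at which item `j` is the unique surplus-maximizing purchase at prices `ρ`. -/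
def favSet {m : ℕ} (ρ : Fin m → ℝ) (j : Fin m) : Set (Fin m → ℝ) :=
  {x | ρ j + altSurplus ρ x j < x j}

/-- The largest positive surplus over all items, or `0`. -/
noncomputable def buyerSurplus {m : ℕ} (ρ x : Fin m → ℝ) : ℝ :=
  (Finset.univ.sup fun j => (x j - ρ j).toNNReal : NNReal)

/-- The Myerson payment of bidder `j` at the profile `x` when it wins on the upward closed
set `W`. -/
noncomputable def thresholdPay {m : ℕ} (W : Set (Fin m → ℝ)) (j : Fin m) (x : Fin m → ℝ) :
    ENNReal :=
  volume {t : ℝ | 0 < t ∧ t < x j ∧ x ∈ W ∧ Function.update x j t ∉ W}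

section Favorite

variable {m : ℕ} {ρ x : Fin m → ℝ} {j j' : Fin m}

lemma altSurplus_nonneg : 0 ≤ altSurplus ρ x j := NNReal.coe_nonneg _

lemma surplus_le_altSurplus (h : j' ≠ j) : x j' - ρ j' ≤ altSurplus ρ x j := by
  refine (Real.le_coe_toNNReal _).trans ?_
  exact NNReal.coe_le_coe.2 (Finset.le_sup (f := fun j' => (x j' - ρ j').toNNReal)
    (Finset.mem_erase.2 ⟨h, Finset.mem_univ _⟩))

lemma altSurplus_update (t : ℝ) :
    altSurplus ρ (Function.update x j t) j = altSurplus ρ x j := by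
  unfold altSurplus
  congr 1
  refine Finset.sup_congr rfl fun j' hj' => ?_
  rw [Function.update_of_ne (Finset.ne_of_mem_erase hj')]

lemma altSurplus_update_price (t : ℝ) :
    altSurplus (Function.update ρ j t) x j = altSurplus ρ x j := by
  unfold altSurplus
  congr 1
  refine Finset.sup_congr rfl fun j' hj' => ?_
  rw [Function.update_of_ne (Finset.ne_of_mem_erase hj')]

lemma altSurplus_eq_zero_or (ρ x : Fin m → ℝ) (j : Fin m) :
    altSurplus ρ x j = 0 ∨ ∃ j', j' ≠ j ∧ altSurplus ρ x j = x j' - ρ j' := by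
  rcases (Finset.univ.erase j).eq_empty_or_nonempty with h | h
  · left; simp [altSurplus, h]
  · obtain ⟨j', hj', h'⟩ := Finset.exists_mem_eq_sup _ h fun j' => (x j' - ρ j').toNNReal
    rcases le_total (x j' - ρ j') 0 with h0 | h0
    · left; rw [altSurplus, h', Real.toNNReal_of_nonpos h0]; rfl
    · right
      exact ⟨j', Finset.ne_of_mem_erase hj', by rw [altSurplus, h', Real.coe_toNNReal _ h0]⟩

lemma buyerSurplus_eq (j : Fin m) :
    buyerSurplus ρ x = max (altSurplus ρ x j) (x j - ρ j) := by
  have h : (Finset.univ : Finset (Fin m)) = insert j (Finset.univ.erase j) :=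
    (Finset.insert_erase (Finset.mem_univ j)).symm
  rw [buyerSurplus, h, Finset.sup_insert, altSurplus, sup_comm, NNReal.coe_max,
    Real.coe_toNNReal', max_left_comm, max_eq_left (b := (0 : ℝ)) ?_]
  · exact max_comm _ _
  · exact NNReal.coe_nonneg _

lemma favSet_disjoint (h : x ∈ favSet ρ j) (h' : x ∈ favSet ρ j') : j = j' := by
  by_contra hne
  have h1 := surplus_le_altSurplus (ρ := ρ) (x := x) hne
  have h2 := surplus_le_altSurplus (ρ := ρ) (x := x) (Ne.symm hne)
  simp only [favSet, Set.mem_ofPred_eq] at h h'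
  linarith

lemma exists_mem_favSet (hne : ∀ j, x j - ρ j ≠ altSurplus ρ x j) :
    (∀ j, x j ≤ ρ j) ∨ ∃ j, x ∈ favSet ρ j := by
  by_cases h0 : ∀ j, x j ≤ ρ j
  · exact Or.inl h0
  right
  push Not at h0
  obtain ⟨i, hi⟩ := h0
  obtain ⟨j, -, hj⟩ := Finset.exists_max_image Finset.univ (fun j => x j - ρ j)
    ⟨i, Finset.mem_univ i⟩
  refine ⟨j, ?_⟩
  have hle : altSurplus ρ x j ≤ x j - ρ j := by
    rcases altSurplus_eq_zero_or ρ x j with h | ⟨j', -, h⟩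
    · rw [h]; have := hj i (Finset.mem_univ i); linarith
    · rw [h]; exact hj j' (Finset.mem_univ j')
  have := lt_of_le_of_ne hle (hne j).symm
  simp only [favSet, Set.mem_ofPred_eq]
  linarith

lemma update_mem_favSet_iff {t : ℝ} :
    Function.update x j t ∈ favSet ρ j ↔ ρ j + altSurplus ρ x j < t := by
  simp [favSet, altSurplus_update]

end Favorite

lemma integral_le_of_subgradient {U q : ℝ → ℝ} {a b : ℝ} (hab : a ≤ b)
    (hq : ∀ t ∈ Set.Icc a b, 0 ≤ q t)
    (h : ∀ s ∈ Set.Icc a b, ∀ t ∈ Set.Icc a b, q t * (s - t) ≤ U s - U t) :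
    ∫ t in a..b, q t ≤ U b - U a := by
  have hmono : MonotoneOn U (Set.Icc a b) := fun t ht s hs hts => by
    have := h s hs t ht
    have := mul_nonneg (hq t ht) (sub_nonneg.2 hts)
    linarith
  have hmem := MonotoneOn.intervalIntegral_deriv_mem_uIcc (f := U) (a := a) (b := b)
    (by rwa [Set.uIcc_of_le hab])
  have hUab : U a ≤ U b := hmono (Set.left_mem_Icc.2 hab) (Set.right_mem_Icc.2 hab) hab
  rw [Set.uIcc_of_le (by linarith)] at hmem
  refine le_trans (le_of_eq ?_) hmem.2
  refine intervalIntegral.integral_congr_ae ?_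
  have hd := hmono.ae_differentiableWithinAt measurableSet_Icc
  rw [ae_restrict_iff' measurableSet_Icc] at hd
  have hb : ∀ᵐ t : ℝ, t ≠ b := by simp [ae_iff]
  filter_upwards [hd, hb] with t ht htb htm
  rw [Set.uIoc_of_le hab] at htm
  have htI : t ∈ Set.Icc a b := ⟨htm.1.le, htm.2⟩
  have hnhds : Set.Icc a b ∈ nhds t := Icc_mem_nhds htm.1 (lt_of_le_of_ne htm.2 htb)
  have hdiff : DifferentiableAt ℝ U t := (ht htI).differentiableAt hnhds
  have hmin : IsLocalMin (fun s => U s - q t * s) t := by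
    filter_upwards [hnhds] with s hs
    have := h s hs t htI
    linarith
  have hder : HasDerivAt (fun s => U s - q t * s) (deriv U t - q t * 1) t :=
    hdiff.hasDerivAt.sub ((hasDerivAt_id t).const_mul (q t))
  have := hmin.hasDerivAt_eq_zero hder
  linarith

lemma ofReal_layer_le {q : ℝ → ℝ} (hqm : Measurable q) {x τ : ℝ} (hτ : 0 ≤ τ) (hx : τ ≤ x)
    (hq0 : ∀ t ∈ Set.Icc τ x, 0 ≤ q t) (hq1 : q x ≤ 1)
    (hmono : MonotoneOn q (Set.Icc τ x)) :
    ENNReal.ofReal (τ * q x + ∫ t in τ..x, (q x - q t)) ≤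
      ∫⁻ y in Set.Ioo (0 : ℝ) 1,
        volume {t : ℝ | 0 < t ∧ t < x ∧ y < q x ∧ ¬(τ < t ∧ y < q t)} := by
  set E : Set (ℝ × ℝ) :=
    {z | 0 < z.2 ∧ z.2 < x ∧ z.1 < q x ∧ ¬(τ < z.2 ∧ z.1 < q z.2)} with hE
  have hEm : MeasurableSet E := by
    refine (measurableSet_lt measurable_const measurable_snd).inter
      ((measurableSet_lt measurable_snd measurable_const).inter
      ((measurableSet_lt measurable_fst measurable_const).inter
      (MeasurableSet.compl ((measurableSet_lt measurable_const measurable_snd).inter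
        (measurableSet_lt measurable_fst (hqm.comp measurable_snd))))))
  have h1 : ∫⁻ y in Set.Ioo (0 : ℝ) 1,
      volume {t : ℝ | 0 < t ∧ t < x ∧ y < q x ∧ ¬(τ < t ∧ y < q t)} =
      ((volume.restrict (Set.Ioo (0 : ℝ) 1)).prod volume) E := by
    rw [Measure.prod_apply hEm]; rfl
  rw [h1, Measure.prod_apply_symm hEm]
  have hxI : x ∈ Set.Icc τ x := Set.right_mem_Icc.2 hx
  have hqint : IntervalIntegrable (fun t => q x - q t) volume τ x := by
    refine intervalIntegrable_const.sub ?_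
    refine MonotoneOn.intervalIntegrable ?_
    rwa [Set.uIcc_of_le hx]
  have hpos : 0 ≤ ∫ t in τ..x, (q x - q t) :=
    intervalIntegral.integral_nonneg hx fun t ht => sub_nonneg.2 (hmono ht hxI ht.2)
  have hsplit : (∫⁻ t in Set.Ioc 0 τ, ENNReal.ofReal (q x)) +
      ∫⁻ t in Set.Ioc τ x, ENNReal.ofReal (q x - q t) =
      ENNReal.ofReal (τ * q x + ∫ t in τ..x, (q x - q t)) := by
    rw [ENNReal.ofReal_add (mul_nonneg hτ (hq0 x hxI)) hpos, intervalIntegral.integral_of_le hx,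
      ofReal_integral_eq_lintegral_ofReal ((intervalIntegrable_iff_integrableOn_Ioc_of_le hx).1
        hqint)]
    · simp [mul_comm, ENNReal.ofReal_mul hτ]
    · refine (ae_restrict_iff' measurableSet_Ioc).2 (Filter.Eventually.of_forall fun t ht => ?_)
      exact sub_nonneg.2 (hmono ⟨ht.1.le, ht.2⟩ hxI ht.2)
  rw [← hsplit]
  set g : ℝ → ENNReal := fun t =>
    (volume.restrict (Set.Ioo (0 : ℝ) 1)) ((fun y => (y, t)) ⁻¹' E) with hg
  have hdisj : Disjoint (Set.Ioc 0 τ) (Set.Ioc τ x) := by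
    rw [Set.disjoint_left]; intro t h1 h2; exact absurd h1.2 (not_le.2 h2.1)
  calc _ ≤ (∫⁻ t in Set.Ioc 0 τ, g t) + ∫⁻ t in Set.Ioc τ x, g t := by
        have hne : ∀ᵐ t : ℝ, t ≠ x := by simp [ae_iff]
        refine add_le_add (lintegral_mono_ae ?_) (lintegral_mono_ae ?_)
        · rw [ae_restrict_iff' measurableSet_Ioc]
          filter_upwards [hne] with t htx ht
          have : Set.Ioo 0 (q x) ⊆ ((fun y => (y, t)) ⁻¹' E) ∩ Set.Ioo 0 1 := fun y hy =>
            ⟨⟨ht.1, lt_of_le_of_ne (ht.2.trans hx) htx, hy.2, fun h => absurd h.1 (not_lt.2 ht.2)⟩,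
              hy.1, hy.2.trans_le hq1⟩
          calc ENNReal.ofReal (q x) = volume (Set.Ioo 0 (q x)) := by simp
            _ ≤ volume (((fun y => (y, t)) ⁻¹' E) ∩ Set.Ioo 0 1) := measure_mono this
            _ ≤ g t := Measure.le_restrict_apply _ _
        · rw [ae_restrict_iff' measurableSet_Ioc]
          filter_upwards [hne] with t htx ht
          have : Set.Ioo (q t) (q x) ⊆ ((fun y => (y, t)) ⁻¹' E) ∩ Set.Ioo 0 1 := fun y hy =>
            ⟨⟨hτ.trans_lt ht.1, lt_of_le_of_ne ht.2 htx, hy.2,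
                fun h => absurd h.2 (not_lt.2 hy.1.le)⟩,
              (hq0 t ⟨ht.1.le, ht.2⟩).trans_lt hy.1, hy.2.trans_le hq1⟩
          calc ENNReal.ofReal (q x - q t) = volume (Set.Ioo (q t) (q x)) := by simp
            _ ≤ volume (((fun y => (y, t)) ⁻¹' E) ∩ Set.Ioo 0 1) := measure_mono this
            _ ≤ g t := Measure.le_restrict_apply _ _
    _ = ∫⁻ t in Set.Ioc 0 τ ∪ Set.Ioc τ x, g t :=
        (lintegral_union measurableSet_Ioc hdisj).symm
    _ ≤ ∫⁻ t, g t := setLIntegral_le_lintegral _ _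

lemma ofReal_price_le {m : ℕ} {ρ : Fin m → ℝ} (hρ : ∀ j, 0 ≤ ρ j)
    {Q : (Fin m → ℝ) → Fin m → ℝ} {p : (Fin m → ℝ) → ℝ}
    (hQm : ∀ j, Measurable fun x => Q x j)
    (hQ0 : ∀ x, (∀ j, 0 ≤ x j) → ∀ j, 0 ≤ Q x j)
    (hQ1 : ∀ x, (∀ j, 0 ≤ x j) → ∑ j, Q x j ≤ 1)
    (hir : ∀ x, (∀ j, 0 ≤ x j) → 0 ≤ (∑ j, Q x j * x j) - p x)
    (hic : ∀ x w, (∀ j, 0 ≤ x j) → (∀ j, 0 ≤ w j) →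
      (∑ j, Q w j * x j) - p w ≤ (∑ j, Q x j * x j) - p x)
    {x : Fin m → ℝ} (hx : ∀ j, 0 ≤ x j) {j : Fin m} (hfav : x ∈ favSet ρ j) :
    ENNReal.ofReal (p x) ≤
      (∫⁻ y in Set.Ioo (0 : ℝ) 1,
        thresholdPay (favSet ρ j ∩ {w | (∀ i, 0 ≤ w i) ∧ y < Q w j}) j x) +
      ENNReal.ofReal (altSurplus ρ x j) + ∑ j', ENNReal.ofReal (Q x j' * ρ j') := by
  set q : ℝ → ℝ := fun t => Q (Function.update x j t) j with hq
  set τ : ℝ := ρ j + altSurplus ρ x j with hτdef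
  have hτ0 : 0 ≤ τ := add_nonneg (hρ j) altSurplus_nonneg
  have hτx : τ < x j := hfav
  have hqx : q (x j) = Q x j := by simp [hq]
  have hup : ∀ t, 0 ≤ t → ∀ i, 0 ≤ Function.update x j t i := fun t ht i => by
    rcases eq_or_ne i j with rfl | h
    · simpa using ht
    · simpa [Function.update_of_ne h] using hx i
  set U : ℝ → ℝ := fun t =>
    (∑ i, Q (Function.update x j t) i * Function.update x j t i) - p (Function.update x j t)
    with hU
  have hsum : ∀ (w : Fin m → ℝ) (s t : ℝ), ∑ i, w i * Function.update x j s i =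
      (∑ i, w i * Function.update x j t i) + w j * (s - t) := fun w s t => by
    rw [← Finset.add_sum_erase _ _ (Finset.mem_univ j),
      ← Finset.add_sum_erase Finset.univ (fun i => w i * Function.update x j t i)
        (Finset.mem_univ j)]
    have : ∑ i ∈ Finset.univ.erase j, w i * Function.update x j s i =
        ∑ i ∈ Finset.univ.erase j, w i * Function.update x j t i :=
      Finset.sum_congr rfl fun i hi => by
        rw [Function.update_of_ne (Finset.ne_of_mem_erase hi),
          Function.update_of_ne (Finset.ne_of_mem_erase hi)]
    rw [this]; simp; ring
  have hsub : ∀ s, 0 ≤ s → ∀ t, 0 ≤ t → q t * (s - t) ≤ U s - U t := fun s hs t ht => by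
    have := hic _ _ (hup s hs) (hup t ht)
    rw [hsum _ s t] at this
    simp only [hU, hq]; linarith
  have hqm : Measurable q := (hQm j).comp (measurable_update x)
  have hq0 : ∀ t, 0 ≤ t → 0 ≤ q t := fun t ht => hQ0 _ (hup t ht) j
  have hmono : ∀ s, 0 ≤ s → ∀ t, s ≤ t → q s ≤ q t := fun s hs t hst => by
    rcases hst.eq_or_lt with rfl | hlt
    · exact le_rfl
    have h1 := hsub s hs t (hs.trans hst)
    have h2 := hsub t (hs.trans hst) s hs
    nlinarith
  have hq1 : q (x j) ≤ 1 := by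
    rw [hqx]
    exact (Finset.single_le_sum (fun i _ => hQ0 x hx i) (Finset.mem_univ j)).trans (hQ1 x hx)
  have hlayer := ofReal_layer_le hqm hτ0 hτx.le (fun t ht => hq0 t (hτ0.trans ht.1)) hq1
    (fun s hs t ht hst => hmono s (hτ0.trans hs.1) t hst)
  have hpay : ∀ y : ℝ, {t : ℝ | 0 < t ∧ t < x j ∧ y < q (x j) ∧ ¬(τ < t ∧ y < q t)} =
      {t : ℝ | 0 < t ∧ t < x j ∧ x ∈ favSet ρ j ∩ {w | (∀ i, 0 ≤ w i) ∧ y < Q w j} ∧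
        Function.update x j t ∉ favSet ρ j ∩ {w | (∀ i, 0 ≤ w i) ∧ y < Q w j}} := fun y => by
    ext t
    simp only [Set.mem_ofPred_eq, Set.mem_inter_iff, update_mem_favSet_iff, hqx]
    constructor
    · rintro ⟨h0, h1, h2, h3⟩
      exact ⟨h0, h1, ⟨hfav, hx, h2⟩, fun h => h3 ⟨h.1, h.2.2⟩⟩
    · rintro ⟨h0, h1, ⟨-, -, h2⟩, h3⟩
      exact ⟨h0, h1, h2, fun h => h3 ⟨h.1, hup t h0.le, h.2⟩⟩
  have hlayer' : ENNReal.ofReal (τ * q (x j) + ∫ t in τ..x j, (q (x j) - q t)) ≤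
      ∫⁻ y in Set.Ioo (0 : ℝ) 1,
        thresholdPay (favSet ρ j ∩ {w | (∀ i, 0 ≤ w i) ∧ y < Q w j}) j x := by
    refine hlayer.trans (le_of_eq ?_)
    refine lintegral_congr fun y => ?_
    rw [hpay y]; rfl
  have hqint : IntervalIntegrable q volume τ (x j) := by
    refine MonotoneOn.intervalIntegrable ?_
    rw [Set.uIcc_of_le hτx.le]
    exact fun s hs t ht hst => hmono s (hτ0.trans hs.1) t hst
  have hUint : ∫ t in τ..x j, q t ≤ U (x j) - U τ :=
    integral_le_of_subgradient hτx.le (fun t ht => hq0 t (hτ0.trans ht.1))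
      fun s hs t ht => hsub s (hτ0.trans hs.1) t (hτ0.trans ht.1)
  have hUτ : 0 ≤ U τ := hir _ (hup τ hτ0)
  have hUx : U (x j) = (∑ i, Q x i * x i) - p x := by simp [hU]
  have hival : ∫ t in τ..x j, (q (x j) - q t) = (x j - τ) * q (x j) - ∫ t in τ..x j, q t := by
    rw [intervalIntegral.integral_sub intervalIntegrable_const hqint]; simp
  have hothers : ∑ i, Q x i * x i ≤ Q x j * x j + altSurplus ρ x j + ∑ i, Q x i * ρ i := by
    have h1 : ∑ i, Q x i * x i = Q x j * (x j - ρ j) +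
        ∑ i ∈ Finset.univ.erase j, Q x i * (x i - ρ i) + ∑ i, Q x i * ρ i := by
      rw [Finset.add_sum_erase _ (fun i => Q x i * (x i - ρ i)) (Finset.mem_univ j),
        ← Finset.sum_add_distrib]
      exact Finset.sum_congr rfl fun i _ => by ring
    have h2 : ∑ i ∈ Finset.univ.erase j, Q x i * (x i - ρ i) ≤ 1 * altSurplus ρ x j := by
      calc _ ≤ ∑ i ∈ Finset.univ.erase j, Q x i * altSurplus ρ x j :=
            Finset.sum_le_sum fun i hi => mul_le_mul_of_nonneg_left
              (surplus_le_altSurplus (Finset.ne_of_mem_erase hi)) (hQ0 x hx i)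
        _ = (∑ i ∈ Finset.univ.erase j, Q x i) * altSurplus ρ x j := by rw [Finset.sum_mul]
        _ ≤ 1 * altSurplus ρ x j := by
            refine mul_le_mul_of_nonneg_right ?_ altSurplus_nonneg
            exact (Finset.sum_le_sum_of_subset_of_nonneg (Finset.subset_univ _)
              fun i _ _ => hQ0 x hx i).trans (hQ1 x hx)
    have h3 := mul_nonneg (hQ0 x hx j) (hρ j)
    linarith
  have hfinal : p x ≤ (τ * q (x j) + ∫ t in τ..x j, (q (x j) - q t)) + altSurplus ρ x j +
      ∑ i, Q x i * ρ i := by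
    rw [hival]; rw [hUx] at hUint; rw [hqx] at *; linarith
  calc ENNReal.ofReal (p x) ≤ _ := ENNReal.ofReal_le_ofReal hfinal
    _ ≤ ENNReal.ofReal (τ * q (x j) + ∫ t in τ..x j, (q (x j) - q t)) +
        ENNReal.ofReal (altSurplus ρ x j) + ENNReal.ofReal (∑ i, Q x i * ρ i) :=
      ENNReal.ofReal_add_le.trans (add_le_add_left ENNReal.ofReal_add_le _)
    _ ≤ _ := by
      rw [ENNReal.ofReal_sum_of_nonneg fun i _ => mul_nonneg (hQ0 x hx i) (hρ i)]
      gcongr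

section ThresholdPay

variable {m : ℕ} {W : Set (Fin m → ℝ)} {j : Fin m} {x : Fin m → ℝ}

lemma thresholdPay_le : thresholdPay W j x ≤ ENNReal.ofReal (x j) := by
  calc thresholdPay W j x ≤ volume (Set.Ioo 0 (x j)) := measure_mono fun t ht => ⟨ht.1, ht.2.1⟩
    _ = _ := by simp

lemma thresholdPay_of_notMem (h : x ∉ W) : thresholdPay W j x = 0 := by
  simp [thresholdPay, h]

lemma thresholdPay_ne_top : thresholdPay W j x ≠ ⊤ :=
  (thresholdPay_le.trans_lt ENNReal.ofReal_lt_top).ne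

lemma toReal_thresholdPay_le (hx : 0 ≤ x j) : (thresholdPay W j x).toReal ≤ x j :=
  ENNReal.toReal_le_of_le_ofReal hx thresholdPay_le

lemma measurable_thresholdPay {Ω : Type*} [MeasurableSpace Ω] {W : Set (Ω × (Fin m → ℝ))}
    (hW : MeasurableSet W) (j : Fin m) :
    Measurable fun z : Ω × (Fin m → ℝ) => thresholdPay {w | (z.1, w) ∈ W} j z.2 := by
  have hj : Measurable fun a : (Ω × (Fin m → ℝ)) × ℝ => a.1.2 j :=
    (measurable_pi_apply j).comp (measurable_snd.comp measurable_fst)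
  have hupd : Measurable fun a : (Ω × (Fin m → ℝ)) × ℝ =>
      (a.1.1, Function.update a.1.2 j a.2) :=
    (measurable_fst.comp measurable_fst).prodMk
      (measurable_update'.comp ((measurable_snd.comp measurable_fst).prodMk measurable_snd))
  have hS : MeasurableSet {a : (Ω × (Fin m → ℝ)) × ℝ | 0 < a.2 ∧ a.2 < a.1.2 j ∧ a.1 ∈ W ∧
      (a.1.1, Function.update a.1.2 j a.2) ∉ W} :=
    (measurableSet_lt measurable_const measurable_snd).inter
      ((measurableSet_lt measurable_snd hj).inter
      ((measurable_fst hW).inter (hupd hW).compl))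
  exact measurable_measure_prodMk_left hS

lemma thresholdPay_ic (hW : ∀ x ∈ W, ∀ t, x j ≤ t → Function.update x j t ∈ W)
    (hx : 0 ≤ x j) (c : ℝ) [Decidable (x ∈ W)] [Decidable (Function.update x j c ∈ W)] :
    (if Function.update x j c ∈ W then x j else 0) -
        (thresholdPay W j (Function.update x j c)).toReal ≤
      (if x ∈ W then x j else 0) - (thresholdPay W j x).toReal := by
  by_cases hc : Function.update x j c ∈ W
  · by_cases hxW : x ∈ W
    · have hset : {t : ℝ | 0 < t ∧ t < Function.update x j c j ∧ Function.update x j c ∈ W ∧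
          Function.update (Function.update x j c) j t ∉ W} =
          {t : ℝ | 0 < t ∧ t < x j ∧ x ∈ W ∧ Function.update x j t ∉ W} := by
        ext t
        simp only [Set.mem_ofPred_eq, Function.update_self, Function.update_idem]
        constructor
        · rintro ⟨h0, -, -, h1⟩
          refine ⟨h0, not_le.1 fun h => h1 (hW x hxW t h), hxW, h1⟩
        · rintro ⟨h0, -, -, h1⟩
          refine ⟨h0, not_le.1 fun h => h1 ?_, hc, h1⟩
          have := hW _ hc t (by simpa using h)
          simpa using this
      simp only [hc, hxW, if_true]
      rw [thresholdPay, hset, thresholdPay]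
    · rw [if_pos hc, if_neg hxW, thresholdPay_of_notMem hxW]
      have hle : x j ≤ (thresholdPay W j (Function.update x j c)).toReal := by
        refine (ENNReal.ofReal_le_iff_le_toReal thresholdPay_ne_top).1 ?_
        calc ENNReal.ofReal (x j) = volume (Set.Ioo 0 (x j)) := by simp
          _ ≤ _ := measure_mono fun t ht => ?_
        have hnot : Function.update x j t ∉ W := fun h => hxW <| by
          have := hW _ h (x j) (by simpa using ht.2.le)
          simpa using this
        refine ⟨ht.1, not_le.1 fun h => hnot ?_, hc, by simpa using hnot⟩
        have := hW _ hc t h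
        simpa using this
      simp only [ENNReal.toReal_zero]; linarith
  · rw [if_neg hc, thresholdPay_of_notMem hc]
    have := toReal_thresholdPay_le (W := W) hx
    by_cases hxW : x ∈ W
    · simp only [hxW, if_true, ENNReal.toReal_zero]; linarith
    · simp [hxW, thresholdPay_of_notMem hxW]

end ThresholdPay

section Mechanism

variable {n m : ℕ} {k : Fin m → ℕ} {F : Fin n → Fin m → Measure ℝ}

/-- The supremum of expected revenue over mechanisms for the copies instance. -/
noncomputable def copiesSup {n m : ℕ} (k : Fin m → ℕ) (F : Fin n → Fin m → Measure ℝ) : ℝ :=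
  sSup {r : ℝ | ∃ (X : (Fin n → Fin m → ℝ) → Finset (Fin n × Fin m))
    (pay : (Fin n → Fin m → ℝ) → Fin n × Fin m → ℝ),
    IsCopiesMech n m k X pay ∧ r = copiesRevenue F pay}

lemma ae_nonneg_pi [∀ i j, IsProbabilityMeasure (F i j)]
    (hF : ∀ i j, F i j (Set.Iio 0) = 0) (i : Fin n) :
    ∀ᵐ x ∂(Measure.pi fun j => F i j), ∀ j, 0 ≤ x j := by
  rw [ae_all_iff]
  intro j
  have h : ∀ᵐ t ∂(F i j), 0 ≤ t := by
    rw [ae_iff]; simpa [not_le, Set.Iio] using hF i j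
  exact (measurePreserving_eval (fun j => F i j) j).quasiMeasurePreserving.ae h

lemma ae_nonneg_valMeasure [∀ i j, IsProbabilityMeasure (F i j)]
    (hF : ∀ i j, F i j (Set.Iio 0) = 0) : ∀ᵐ v ∂(valMeasure F), ∀ i j, 0 ≤ v i j := by
  rw [ae_all_iff]
  intro i
  exact (measurePreserving_eval (fun i => Measure.pi fun j => F i j)
    i).quasiMeasurePreserving.ae (ae_nonneg_pi hF i)

instance [∀ i j, IsProbabilityMeasure (F i j)] : IsProbabilityMeasure (valMeasure F) := by
  unfold valMeasure; infer_instance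

lemma integrable_pi_entry [∀ i j, IsProbabilityMeasure (F i j)]
    (hF : ∀ i j, Integrable id (F i j)) (i : Fin n) (j : Fin m) :
    Integrable (fun x : Fin m → ℝ => x j) (Measure.pi fun j => F i j) :=
  (measurePreserving_eval (fun j => F i j) j).integrable_comp_of_integrable (hF i j)

lemma integrable_valMeasure_entry [∀ i j, IsProbabilityMeasure (F i j)]
    (hF : ∀ i j, Integrable id (F i j)) (i : Fin n) (j : Fin m) :
    Integrable (fun v : Fin n → Fin m → ℝ => v i j) (valMeasure F) :=
  (measurePreserving_eval (fun i => Measure.pi fun j => F i j)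
    i).integrable_comp_of_integrable (integrable_pi_entry hF i j)

lemma IsCopiesMech.pay_le {X : (Fin n → Fin m → ℝ) → Finset (Fin n × Fin m)}
    {pay : (Fin n → Fin m → ℝ) → Fin n × Fin m → ℝ} (h : IsCopiesMech n m k X pay)
    {v : Fin n → Fin m → ℝ} (hv : ∀ i j, 0 ≤ v i j) (e : Fin n × Fin m) :
    pay v e ≤ v e.1 e.2 := by
  have := h.ir v hv e
  have := hv e.1 e.2
  split_ifs at * <;> linarith

lemma IsCopiesMech.integrable_pay [∀ i j, IsProbabilityMeasure (F i j)]
    (hF_nonneg : ∀ i j, F i j (Set.Iio 0) = 0) (hF_mean : ∀ i j, Integrable id (F i j))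
    {X : (Fin n → Fin m → ℝ) → Finset (Fin n × Fin m)}
    {pay : (Fin n → Fin m → ℝ) → Fin n × Fin m → ℝ} (h : IsCopiesMech n m k X pay)
    (e : Fin n × Fin m) : Integrable (fun v => pay v e) (valMeasure F) := by
  refine (integrable_valMeasure_entry hF_mean e.1 e.2).mono' (h.measPay e).aestronglyMeasurable ?_
  filter_upwards [ae_nonneg_valMeasure hF_nonneg] with v hv
  rw [Real.norm_of_nonneg (h.pay_nonneg v e)]
  exact h.pay_le hv e

lemma bddAbove_copiesRevenue [∀ i j, IsProbabilityMeasure (F i j)]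
    (hF_nonneg : ∀ i j, F i j (Set.Iio 0) = 0) (hF_mean : ∀ i j, Integrable id (F i j)) :
    BddAbove {r : ℝ | ∃ (X : (Fin n → Fin m → ℝ) → Finset (Fin n × Fin m))
      (pay : (Fin n → Fin m → ℝ) → Fin n × Fin m → ℝ),
      IsCopiesMech n m k X pay ∧ r = copiesRevenue F pay} := by
  refine ⟨∫ v, ∑ e : Fin n × Fin m, v e.1 e.2 ∂(valMeasure F), ?_⟩
  rintro r ⟨X, pay, h, rfl⟩
  refine integral_mono_ae (integrable_finsetSum _ fun e _ =>
    h.integrable_pay hF_nonneg hF_mean e) (integrable_finsetSum _ fun e _ =>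
    integrable_valMeasure_entry hF_mean e.1 e.2) ?_
  filter_upwards [ae_nonneg_valMeasure hF_nonneg] with v hv
  exact Finset.sum_le_sum fun e _ => h.pay_le hv e

lemma IsCopiesMech.lintegral_pay_le [∀ i j, IsProbabilityMeasure (F i j)]
    (hF_nonneg : ∀ i j, F i j (Set.Iio 0) = 0) (hF_mean : ∀ i j, Integrable id (F i j))
    {X : (Fin n → Fin m → ℝ) → Finset (Fin n × Fin m)}
    {pay : (Fin n → Fin m → ℝ) → Fin n × Fin m → ℝ} (h : IsCopiesMech n m k X pay) :
    ∑ e, ∫⁻ v, ENNReal.ofReal (pay v e) ∂(valMeasure F) ≤ ENNReal.ofReal (copiesSup k F) := by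
  have hle : copiesRevenue F pay ≤ copiesSup k F :=
    le_csSup (bddAbove_copiesRevenue hF_nonneg hF_mean) ⟨X, pay, h, rfl⟩
  refine le_trans (le_of_eq ?_) (ENNReal.ofReal_le_ofReal hle)
  rw [copiesRevenue, integral_finsetSum _ fun e _ => h.integrable_pay hF_nonneg hF_mean e,
    ENNReal.ofReal_sum_of_nonneg fun e _ => integral_nonneg fun v => h.pay_nonneg v e]
  refine Finset.sum_congr rfl fun e _ => ?_
  rw [ofReal_integral_eq_lintegral_ofReal (h.integrable_pay hF_nonneg hF_mean e)
    (Filter.Eventually.of_forall fun v => h.pay_nonneg v e)]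

open Classical in
/-- The number of agents preceding `i` in the order `ord` that demand item `j`. -/
noncomputable def earlierDemand {n m : ℕ} (ord : Fin n → ℤ) (C : Fin n → Fin m → Set (Fin m → ℝ))
    (v : Fin n → Fin m → ℝ) (i : Fin n) (j : Fin m) : ℕ :=
  (Finset.univ.filter fun i' => ord i' < ord i ∧ v i' ∈ C i' j).card

lemma measurable_earlierDemand (ord : Fin n → ℤ) {C : Fin n → Fin m → Set (Fin m → ℝ)}
    (hC : ∀ i j, MeasurableSet (C i j)) (i : Fin n) (j : Fin m) :
    Measurable fun v => earlierDemand ord C v i j := by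
  simp only [earlierDemand, Finset.card_filter]
  refine Finset.measurable_sum _ fun i' _ => Measurable.ite ?_ measurable_const measurable_const
  by_cases h : ord i' < ord i
  · have := (measurable_pi_apply i' : Measurable fun v : Fin n → Fin m → ℝ => v i') (hC i' j)
    simp only [h, true_and]
    exact this
  · simp [h]

open Classical in
lemma isCopiesMech_sequential (ord : Fin n → ℤ) (hord : Function.Injective ord)
    {C W : Fin n → Fin m → Set (Fin m → ℝ)} (hC : ∀ i j, MeasurableSet (C i j))
    (hWm : ∀ i j, MeasurableSet (W i j)) (hWC : ∀ i j, W i j ⊆ C i j)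
    (hdisj : ∀ i j j' x, x ∈ C i j → x ∈ C i j' → j = j')
    (hup : ∀ i j, ∀ x ∈ W i j, ∀ t, x j ≤ t → Function.update x j t ∈ W i j) :
    IsCopiesMech n m k
      (fun v => Finset.univ.filter fun e => v e.1 ∈ W e.1 e.2 ∧
        earlierDemand ord C v e.1 e.2 < k e.2)
      (fun v e => if earlierDemand ord C v e.1 e.2 < k e.2 then
        (thresholdPay (W e.1 e.2) e.2 (v e.1)).toReal else 0) where
  feas v := by
    refine ⟨fun i => ?_, fun j => ?_⟩
    · rw [Finset.card_le_one]
      rintro ⟨a, b⟩ ha ⟨c, d⟩ hc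
      simp only [Finset.mem_filter, Finset.mem_univ, true_and] at ha hc
      obtain ⟨⟨ha, -⟩, rfl⟩ := ha
      obtain ⟨⟨hc, -⟩, rfl⟩ := hc
      rw [hdisj _ _ _ _ (hWC _ _ ha) (hWC _ _ hc)]
    · set T := (Finset.univ.filter fun e : Fin n × Fin m => v e.1 ∈ W e.1 e.2 ∧
        earlierDemand ord C v e.1 e.2 < k e.2).filter fun e => e.2 = j with hT
      rcases T.eq_empty_or_nonempty with h | h
      · simp [h]
      obtain ⟨⟨i, j'⟩, hmem, hmax⟩ := Finset.exists_max_image T (fun e => ord e.1) h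
      have hmem' := hmem
      simp only [hT, Finset.mem_filter, Finset.mem_univ, true_and] at hmem'
      obtain ⟨⟨-, hlt⟩, rfl⟩ := hmem'
      have hsub : (T.erase (i, j')).card ≤ earlierDemand ord C v i j' := by
        refine Finset.card_le_card_of_injOn Prod.fst ?_ ?_
        · rintro ⟨a, b⟩ hab
          obtain ⟨hne, hab⟩ := Finset.mem_erase.1 hab
          have hle := hmax _ hab
          simp only [hT, Finset.mem_filter, Finset.mem_univ, true_and] at hab
          obtain ⟨⟨hW, -⟩, rfl⟩ := hab
          simp only [Finset.coe_filter, Finset.mem_univ, true_and, Set.mem_ofPred_eq]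
          refine ⟨lt_of_le_of_ne hle fun h => hne ?_, hWC _ _ hW⟩
          rw [hord h]
        · rintro ⟨a, b⟩ hab ⟨c, d⟩ hcd (rfl : a = c)
          have h1 := Finset.mem_of_mem_erase hab
          have h2 := Finset.mem_of_mem_erase hcd
          simp only [hT, Finset.mem_filter, Finset.mem_univ, true_and] at h1 h2
          rw [h1.2, h2.2]
      have := Finset.card_erase_add_one hmem
      omega
  measX S := by
    have : {v | (Finset.univ.filter fun e : Fin n × Fin m => v e.1 ∈ W e.1 e.2 ∧
        earlierDemand ord C v e.1 e.2 < k e.2) = S} =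
        ⋂ e : Fin n × Fin m, {v | (v e.1 ∈ W e.1 e.2 ∧
          earlierDemand ord C v e.1 e.2 < k e.2) ↔ e ∈ S} := by
      ext v
      simp [Finset.ext_iff]
    rw [this]
    refine MeasurableSet.iInter fun e => ?_
    have hm : MeasurableSet {v : Fin n → Fin m → ℝ | v e.1 ∈ W e.1 e.2 ∧
        earlierDemand ord C v e.1 e.2 < k e.2} :=
      (measurable_pi_apply e.1 (hWm e.1 e.2)).inter
        (measurable_earlierDemand ord hC e.1 e.2 measurableSet_Iio)
    by_cases he : e ∈ S
    · simpa [he] using hm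
    · simp only [he, iff_false]; exact hm.compl
  measPay e := by
    refine Measurable.ite (measurable_earlierDemand ord hC e.1 e.2 measurableSet_Iio) ?_
      measurable_const
    have h := measurable_thresholdPay (Ω := Unit) (W := Prod.snd ⁻¹' W e.1 e.2)
      (measurable_snd (hWm e.1 e.2)) e.2
    exact (h.comp (f := fun v : Fin n → Fin m → ℝ => ((), v e.1))
      (measurable_const.prodMk (measurable_pi_apply e.1))).ennreal_toReal
  pay_nonneg v e := by
    split_ifs
    · exact ENNReal.toReal_nonneg
    · exact le_rfl
  ic v hv i j c hc := by
    have hD : earlierDemand ord C (updateEntry v i j c) i j = earlierDemand ord C v i j := by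
      unfold earlierDemand updateEntry
      congr 1
      refine Finset.filter_congr fun i' _ => ?_
      refine and_congr_right fun hlt => ?_
      rw [Function.update_of_ne fun h => by simp [h] at hlt]
    have hself : updateEntry v i j c i = Function.update (v i) j c := by simp [updateEntry]
    simp only [Finset.mem_filter, Finset.mem_univ, true_and, hD, hself]
    by_cases h : earlierDemand ord C v i j < k j
    · simp only [h, and_true, if_true]
      exact thresholdPay_ic (hup i j) (hv i j) c
    · simp [h]
  ir v hv e := by
    simp only [Finset.mem_filter, Finset.mem_univ, true_and]
    by_cases h : earlierDemand ord C v e.1 e.2 < k e.2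
    · by_cases hW : v e.1 ∈ W e.1 e.2
      · simp only [h, hW, and_true, if_true, sub_nonneg]
        exact toReal_thresholdPay_le (hv e.1 e.2)
      · simp [hW, thresholdPay_of_notMem hW]
    · simp [h]

end Mechanism

section PiMeasure

variable {ι α : Type*} [Fintype ι] [MeasurableSpace α] {μ : ι → Measure α}
  [∀ i, IsProbabilityMeasure (μ i)]

lemma lintegral_pi_eval {f : α → ENNReal} (hf : Measurable f) (i : ι) :
    ∫⁻ v, f (v i) ∂(Measure.pi μ) = ∫⁻ x, f x ∂(μ i) :=
  (measurePreserving_eval μ i).lintegral_comp hf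

lemma lintegral_pi_mul {f g : α → ENNReal} (hf : Measurable f) (hg : Measurable g) {i i' : ι}
    (h : i ≠ i') :
    ∫⁻ v, f (v i) * g (v i') ∂(Measure.pi μ) = (∫⁻ x, f x ∂(μ i)) * ∫⁻ x, g x ∂(μ i') := by
  have hind := (ProbabilityTheory.iIndepFun_pi (μ := μ) (X := fun _ x => x)
    fun i => aemeasurable_id).indepFun h
  have hind' : ProbabilityTheory.IndepFun (fun v : ι → α => f (v i)) (fun v => g (v i'))
      (Measure.pi μ) := hind.comp hf hg
  have := ProbabilityTheory.lintegral_mul_eq_lintegral_mul_lintegral_of_indepFun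
    (hf.comp (measurable_pi_apply i)) (hg.comp (measurable_pi_apply i')) hind'
  rw [← lintegral_pi_eval hf i, ← lintegral_pi_eval hg i']
  exact this

end PiMeasure

section Mechanism

variable {n m : ℕ} {k : Fin m → ℕ} {F : Fin n → Fin m → Measure ℝ}

open Classical in
lemma sum_lintegral_thresholdPay_le_of_order [∀ i j, IsProbabilityMeasure (F i j)]
    (hk : ∀ j, 1 ≤ k j)
    (hF_nonneg : ∀ i j, F i j (Set.Iio 0) = 0) (hF_mean : ∀ i j, Integrable id (F i j))
    (ord : Fin n → ℤ) (hord : Function.Injective ord)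
    {C W : Fin n → Fin m → Set (Fin m → ℝ)} (hC : ∀ i j, MeasurableSet (C i j))
    (hWm : ∀ i j, MeasurableSet (W i j)) (hWC : ∀ i j, W i j ⊆ C i j)
    (hdisj : ∀ i j j' x, x ∈ C i j → x ∈ C i j' → j = j')
    (hup : ∀ i j, ∀ x ∈ W i j, ∀ t, x j ≤ t → Function.update x j t ∈ W i j) :
    ∑ i, ∑ j, ∫⁻ x, thresholdPay (W i j) j x ∂(Measure.pi fun j => F i j) ≤
      ENNReal.ofReal (copiesSup k F) +
      ∑ i, ∑ j, ∑ i', if ord i' < ord i then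
        (k j : ENNReal)⁻¹ * ((∫⁻ x, thresholdPay (W i j) j x ∂(Measure.pi fun j => F i j)) *
          (Measure.pi fun j => F i' j) (C i' j)) else 0 := by
  have htm : ∀ i j, Measurable fun x => thresholdPay (W i j) j x := fun i j =>
    (measurable_thresholdPay (Ω := Unit) (W := Prod.snd ⁻¹' W i j)
      (measurable_snd (hWm i j)) j).comp (f := fun x : Fin m → ℝ => ((), x))
      (measurable_const.prodMk measurable_id)
  have hmech := (isCopiesMech_sequential (k := k) ord hord hC hWm hWC hdisj
    hup).lintegral_pay_le hF_nonneg hF_mean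
  have hpt : ∀ (v : Fin n → Fin m → ℝ) (i : Fin n) (j : Fin m),
      thresholdPay (W i j) j (v i) ≤
        ENNReal.ofReal (if earlierDemand ord C v i j < k j then
          (thresholdPay (W i j) j (v i)).toReal else 0) +
        ∑ i', if ord i' < ord i then (k j : ENNReal)⁻¹ *
          (thresholdPay (W i j) j (v i) * (C i' j).indicator 1 (v i')) else 0 := by
    intro v i j
    by_cases h : earlierDemand ord C v i j < k j
    · rw [if_pos h, ENNReal.ofReal_toReal thresholdPay_ne_top]
      exact le_self_add
    · rw [if_neg h, ENNReal.ofReal_zero, zero_add]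
      have hsum : (∑ i', if ord i' < ord i then (k j : ENNReal)⁻¹ *
          (thresholdPay (W i j) j (v i) * (C i' j).indicator 1 (v i')) else 0) =
          (k j : ENNReal)⁻¹ * (earlierDemand ord C v i j : ENNReal) *
            thresholdPay (W i j) j (v i) := by
        rw [earlierDemand, Finset.card_filter, Nat.cast_sum, Finset.mul_sum, Finset.sum_mul]
        refine Finset.sum_congr rfl fun i' _ => ?_
        by_cases h1 : ord i' < ord i <;> by_cases h2 : v i' ∈ C i' j <;> simp [h1, h2]
      rw [hsum]
      have hk0 : (k j : ENNReal) ≠ 0 := by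
        have := hk j
        exact_mod_cast (by omega : k j ≠ 0)
      calc thresholdPay (W i j) j (v i) = 1 * thresholdPay (W i j) j (v i) := (one_mul _).symm
        _ ≤ _ := by
          gcongr
          rw [← ENNReal.inv_mul_cancel hk0 (ENNReal.natCast_ne_top _)]
          gcongr
          exact not_lt.1 h
  have hprod : ∀ i j i', ord i' < ord i →
      ∫⁻ v, thresholdPay (W i j) j (v i) * (C i' j).indicator 1 (v i') ∂(valMeasure F) =
      (∫⁻ x, thresholdPay (W i j) j x ∂(Measure.pi fun j => F i j)) *
          (Measure.pi fun j => F i' j) (C i' j) := fun i j i' h => by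
    rw [valMeasure, lintegral_pi_mul (htm i j) (measurable_one.indicator (hC i' j))
      (fun h' => by simp [h'] at h), lintegral_indicator_one (hC i' j)]
  have hpm : ∀ i j, Measurable fun v : Fin n → Fin m → ℝ => thresholdPay (W i j) j (v i) :=
    fun i j => (htm i j).comp (measurable_pi_apply i)
  have hprodm : ∀ i j i', Measurable fun v : Fin n → Fin m → ℝ =>
      thresholdPay (W i j) j (v i) * (C i' j).indicator 1 (v i') := fun i j i' =>
    (hpm i j).mul ((measurable_one.indicator (hC i' j)).comp (measurable_pi_apply i'))
  have hitem : ∀ i j, ∫⁻ x, thresholdPay (W i j) j x ∂(Measure.pi fun j => F i j) ≤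
      (∫⁻ v, ENNReal.ofReal (if earlierDemand ord C v i j < k j then
          (thresholdPay (W i j) j (v i)).toReal else 0) ∂(valMeasure F)) +
      ∑ i', if ord i' < ord i then
        (k j : ENNReal)⁻¹ * ((∫⁻ x, thresholdPay (W i j) j x ∂(Measure.pi fun j => F i j)) *
          (Measure.pi fun j => F i' j) (C i' j)) else 0 := fun i j => by
    calc ∫⁻ x, thresholdPay (W i j) j x ∂(Measure.pi fun j => F i j)
        = ∫⁻ v, thresholdPay (W i j) j (v i) ∂(valMeasure F) :=
          (lintegral_pi_eval (μ := fun i => Measure.pi fun j => F i j) (htm i j) i).symm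
      _ ≤ _ := lintegral_mono fun v => hpt v i j
      _ = _ := by
        rw [lintegral_add_right, lintegral_finsetSum]
        · congr 1
          refine Finset.sum_congr rfl fun i' _ => ?_
          split_ifs with h
          · rw [lintegral_const_mul _ (hprodm i j i'), hprod i j i' h]
          · simp
        · intro i' _
          split_ifs
          · exact (hprodm i j i').const_mul _
          · exact measurable_const
        · refine Finset.measurable_sum _ fun i' _ => ?_
          split_ifs
          · exact (hprodm i j i').const_mul _
          · exact measurable_const
  calc _ ≤ _ := Finset.sum_le_sum fun i _ => Finset.sum_le_sum fun j _ => hitem i j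
    _ ≤ _ := by
      simp only [Finset.sum_add_distrib]
      gcongr
      rw [← Fintype.sum_prod_type' (f := fun i j => ∫⁻ v, ENNReal.ofReal
        (if earlierDemand ord C v i j < k j then
          (thresholdPay (W i j) j (v i)).toReal else 0) ∂(valMeasure F))]
      exact hmech

open Classical in
lemma sum_lintegral_thresholdPay_le {Ω : Type*} [MeasurableSpace Ω] (μ : Measure Ω)
    [IsProbabilityMeasure μ] [∀ i j, IsProbabilityMeasure (F i j)]
    (hk : ∀ j, 1 ≤ k j)
    (hF_nonneg : ∀ i j, F i j (Set.Iio 0) = 0) (hF_mean : ∀ i j, Integrable id (F i j))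
    {C W : Fin n → Fin m → Set (Ω × (Fin m → ℝ))} (hC : ∀ i j, MeasurableSet (C i j))
    (hWm : ∀ i j, MeasurableSet (W i j)) (hWC : ∀ i j, W i j ⊆ C i j)
    (hdisj : ∀ i j j' z, z ∈ C i j → z ∈ C i j' → j = j')
    (hup : ∀ i j, ∀ z ∈ W i j, ∀ t, z.2 j ≤ t → (z.1, Function.update z.2 j t) ∈ W i j)
    (hD : ∀ j, ∑ i, (μ.prod (Measure.pi fun j => F i j)) (C i j) ≤ k j) :
    ∑ i, ∑ j, ∫⁻ z, thresholdPay {w | (z.1, w) ∈ W i j} j z.2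
        ∂(μ.prod (Measure.pi fun j => F i j)) ≤
      2 * ENNReal.ofReal (copiesSup k F) := by
  set ν : Fin n → Measure (Fin m → ℝ) := fun i => Measure.pi fun j => F i j with hν
  set g : Fin n → Fin m → Ω → ENNReal := fun i j ω =>
    ∫⁻ x, thresholdPay {w | (ω, w) ∈ W i j} j x ∂(ν i) with hg
  set d : Fin n → Fin m → Ω → ENNReal := fun i j ω => ν i {w | (ω, w) ∈ C i j} with hd
  have hgm : ∀ i j, Measurable (g i j) := fun i j =>
    (measurable_thresholdPay (hWm i j) j).lintegral_prod_right'
  have hdm : ∀ i j, Measurable (d i j) := fun i j => measurable_measure_prodMk_left (hC i j)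
  have hgint : ∀ i j, ∫⁻ ω, g i j ω ∂μ = ∫⁻ z, thresholdPay {w | (z.1, w) ∈ W i j} j z.2
      ∂(μ.prod (ν i)) := fun i j =>
    (lintegral_prod _ (measurable_thresholdPay (hWm i j) j).aemeasurable).symm
  have hdint : ∀ i j, ∫⁻ ω, d i j ω ∂μ = (μ.prod (ν i)) (C i j) := fun i j =>
    (Measure.prod_apply (hC i j)).symm
  have hgfin : ∀ i j, ∫⁻ ω, g i j ω ∂μ ≠ ⊤ := fun i j => by
    refine ne_top_of_le_ne_top (b := ∫⁻ x, ENNReal.ofReal (x j) ∂(ν i))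
      (integrable_pi_entry hF_mean i j).lintegral_lt_top.ne ?_
    calc ∫⁻ ω, g i j ω ∂μ ≤ ∫⁻ _, (∫⁻ x, ENNReal.ofReal (x j) ∂(ν i)) ∂μ :=
          lintegral_mono fun ω => lintegral_mono fun x => thresholdPay_le
      _ = _ := by simp
  have hord : ∀ ord : Fin n → ℤ, Function.Injective ord →
      ∑ i, ∑ j, ∫⁻ ω, g i j ω ∂μ ≤ ENNReal.ofReal (copiesSup k F) +
        ∑ i, ∑ j, ∑ i', if ord i' < ord i then
        (k j : ENNReal)⁻¹ * ((∫⁻ ω, g i j ω ∂μ) * ∫⁻ ω, d i' j ω ∂μ) else 0 := by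
    intro ord hinj
    have hfix : ∀ u : Fin n → Ω, ∑ i, ∑ j, g i j (u i) ≤ ENNReal.ofReal (copiesSup k F) +
        ∑ i, ∑ j, ∑ i', if ord i' < ord i then
        (k j : ENNReal)⁻¹ * (g i j (u i) * d i' j (u i')) else 0 := fun u =>
      sum_lintegral_thresholdPay_le_of_order (C := fun i j => {w | (u i, w) ∈ C i j})
        (W := fun i j => {w | (u i, w) ∈ W i j}) hk hF_nonneg hF_mean ord hinj
        (fun i j => measurable_prodMk_left (hC i j)) (fun i j => measurable_prodMk_left (hWm i j))
        (fun i j x hx => hWC i j hx) (fun i j j' x h h' => hdisj i j j' _ h h')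
        (fun i j x hx t ht => hup i j _ hx t ht)
    have hgm' : ∀ i j, Measurable fun u : Fin n → Ω => g i j (u i) := fun i j =>
      (hgm i j).comp (measurable_pi_apply i)
    have htm : ∀ i j i', Measurable fun u : Fin n → Ω => if ord i' < ord i then
        (k j : ENNReal)⁻¹ * (g i j (u i) * d i' j (u i')) else 0 := fun i j i' => by
      split_ifs
      · exact ((hgm' i j).mul ((hdm i' j).comp (measurable_pi_apply i'))).const_mul _
      · exact measurable_const
    calc ∑ i, ∑ j, ∫⁻ ω, g i j ω ∂μ
        = ∫⁻ u, ∑ i, ∑ j, g i j (u i) ∂(Measure.pi fun _ : Fin n => μ) := by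
          rw [lintegral_finsetSum _ fun i _ => Finset.measurable_sum _ fun j _ => hgm' i j]
          refine Finset.sum_congr rfl fun i _ => ?_
          rw [lintegral_finsetSum _ fun j _ => hgm' i j]
          exact Finset.sum_congr rfl fun j _ =>
            (lintegral_pi_eval (μ := fun _ : Fin n => μ) (hgm i j) i).symm
      _ ≤ _ := lintegral_mono hfix
      _ = _ := by
        rw [lintegral_add_left measurable_const, lintegral_const, measure_univ, mul_one,
          lintegral_finsetSum _ fun i _ => Finset.measurable_sum _ fun j _ =>
            Finset.measurable_sum _ fun i' _ => htm i j i']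
        congr 1
        refine Finset.sum_congr rfl fun i _ => ?_
        rw [lintegral_finsetSum _ fun j _ => Finset.measurable_sum _ fun i' _ => htm i j i']
        refine Finset.sum_congr rfl fun j _ => ?_
        rw [lintegral_finsetSum _ fun i' _ => htm i j i']
        refine Finset.sum_congr rfl fun i' _ => ?_
        split_ifs with h
        · have hmul : Measurable fun u : Fin n → Ω => g i j (u i) * d i' j (u i') :=
            (hgm' i j).mul ((hdm i' j).comp (measurable_pi_apply i'))
          rw [lintegral_const_mul _ hmul, lintegral_pi_mul (μ := fun _ : Fin n => μ) (hgm i j)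
            (hdm i' j) (fun h' => by simp [h'] at h)]
        · simp
  set G := ∑ i, ∑ j, ∫⁻ ω, g i j ω ∂μ with hG
  have hGfin : G ≠ ⊤ := ENNReal.sum_ne_top.2 fun i _ => ENNReal.sum_ne_top.2 fun j _ => hgfin i j
  have h1 := hord (fun i => (i : ℤ)) fun a b h => by simpa [Fin.ext_iff] using h
  have h2 := hord (fun i => -(i : ℤ)) fun a b h => by simpa [Fin.ext_iff] using h
  have h3 : (∑ i : Fin n, ∑ j, ∑ i' : Fin n, if (i' : ℤ) < (i : ℤ) then
        (k j : ENNReal)⁻¹ * ((∫⁻ ω, g i j ω ∂μ) * ∫⁻ ω, d i' j ω ∂μ) else 0) +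
      (∑ i : Fin n, ∑ j, ∑ i' : Fin n, if -(i' : ℤ) < -(i : ℤ) then
        (k j : ENNReal)⁻¹ * ((∫⁻ ω, g i j ω ∂μ) * ∫⁻ ω, d i' j ω ∂μ) else 0) ≤ G := by
    simp only [← Finset.sum_add_distrib]
    refine Finset.sum_le_sum fun i _ => Finset.sum_le_sum fun j _ => ?_
    calc _ ≤ ∑ i', (k j : ENNReal)⁻¹ * ((∫⁻ ω, g i j ω ∂μ) * ∫⁻ ω, d i' j ω ∂μ) := by
          refine Finset.sum_le_sum fun i' _ => ?_
          by_cases ha : (i' : ℤ) < (i : ℤ)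
          · have hb : ¬ (-(i' : ℤ) < -(i : ℤ)) := by omega
            rw [if_pos ha, if_neg hb, add_zero]
          · rw [if_neg ha, zero_add]
            split_ifs
            · exact le_rfl
            · exact zero_le
      _ = (k j : ENNReal)⁻¹ * (∑ i', ∫⁻ ω, d i' j ω ∂μ) * ∫⁻ ω, g i j ω ∂μ := by
          rw [Finset.mul_sum, Finset.sum_mul]
          exact Finset.sum_congr rfl fun i' _ => by ring
      _ ≤ 1 * ∫⁻ ω, g i j ω ∂μ := by
          gcongr
          have hk0 : (k j : ENNReal) ≠ 0 := by
            have := hk j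
            exact_mod_cast (by omega : k j ≠ 0)
          rw [← ENNReal.inv_mul_cancel hk0 (ENNReal.natCast_ne_top _)]
          gcongr
          simp only [hdint]
          exact hD j
      _ = _ := one_mul _
  have hfinal : G + G ≤ 2 * ENNReal.ofReal (copiesSup k F) + G := by
    refine (add_le_add h1 h2).trans ?_
    rw [add_add_add_comm, two_mul]
    exact add_le_add le_rfl h3
  have := (ENNReal.add_le_add_iff_right hGfin).1 hfinal
  simpa only [hG, hgint] using this

end Mechanism

section ClearingPrice

variable {m : ℕ} {ρ x : Fin m → ℝ} {j : Fin m}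

lemma continuous_altSurplus (j : Fin m) :
    Continuous fun z : (Fin m → ℝ) × (Fin m → ℝ) => altSurplus z.1 z.2 j := by
  unfold altSurplus
  refine NNReal.continuous_coe.comp (Continuous.finset_sup_apply fun j' _ => ?_)
  exact continuous_real_toNNReal.comp (by fun_prop)

lemma continuous_buyerSurplus :
    Continuous fun z : (Fin m → ℝ) × (Fin m → ℝ) => buyerSurplus z.1 z.2 := by
  unfold buyerSurplus
  refine NNReal.continuous_coe.comp (Continuous.finset_sup_apply fun j' _ => ?_)
  exact continuous_real_toNNReal.comp (by fun_prop)

lemma measurableSet_favSet (j : Fin m) :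
    MeasurableSet {z : (Fin m → ℝ) × (Fin m → ℝ) | z.2 ∈ favSet z.1 j} :=
  measurableSet_lt (((measurable_pi_apply j).comp measurable_fst).add
    (continuous_altSurplus j).measurable) ((measurable_pi_apply j).comp measurable_snd)

lemma buyerSurplus_nonneg : 0 ≤ buyerSurplus ρ x := NNReal.coe_nonneg _

lemma surplus_le_buyerSurplus (j : Fin m) : x j - ρ j ≤ buyerSurplus ρ x := by
  rw [buyerSurplus_eq j]
  exact le_max_right _ _

lemma buyerSurplus_le {c : ℝ} (hc : 0 ≤ c) (h : ∀ j, x j - ρ j ≤ c) : buyerSurplus ρ x ≤ c := by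
  lift c to NNReal using hc
  exact NNReal.coe_le_coe.2 (Finset.sup_le fun j _ => Real.toNNReal_le_iff_le_coe.2 (h j))

lemma buyerSurplus_le_add_dist (ρ ρ' x : Fin m → ℝ) :
    buyerSurplus ρ x ≤ buyerSurplus ρ' x + dist ρ ρ' := by
  refine buyerSurplus_le (add_nonneg buyerSurplus_nonneg dist_nonneg) fun j => ?_
  have h1 := surplus_le_buyerSurplus (ρ := ρ') (x := x) j
  have h2 := dist_le_pi_dist ρ ρ' j
  rw [Real.dist_eq] at h2
  have := neg_abs_le (ρ j - ρ' j)
  linarith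

lemma buyerSurplus_le_sum : buyerSurplus ρ x ≤ ∑ j, |x j - ρ j| :=
  buyerSurplus_le (Finset.sum_nonneg fun _ _ => abs_nonneg _) fun j =>
    (le_abs_self _).trans
      (Finset.single_le_sum (f := fun j => |x j - ρ j|) (fun _ _ => abs_nonneg _)
        (Finset.mem_univ j))

lemma integrable_buyerSurplus {η : Measure (Fin m → ℝ)} [IsProbabilityMeasure η]
    (hη : ∀ j, Integrable (fun x : Fin m → ℝ => x j) η) (ρ : Fin m → ℝ) :
    Integrable (buyerSurplus ρ) η := by
  refine Integrable.mono' (g := fun x => ∑ j, |x j - ρ j|)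
    (integrable_finsetSum _ fun j _ => ((hη j).sub (integrable_const _)).abs)
    (continuous_buyerSurplus.comp (by fun_prop : Continuous fun x => (ρ, x))).aestronglyMeasurable
    (Filter.Eventually.of_forall fun x => ?_)
  rw [Real.norm_of_nonneg buyerSurplus_nonneg]
  exact buyerSurplus_le_sum

lemma hasDerivAt_max_sub {a b t : ℝ} (h : b - t ≠ a) :
    HasDerivAt (fun s => max a (b - s)) (if t + a < b then -1 else 0) t := by
  have hd : HasDerivAt (fun s => b - s) (-1) t := by
    simpa using (hasDerivAt_id t).const_sub b
  split_ifs with hlt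
  · refine hd.congr_of_eventuallyEq ?_
    filter_upwards [Iio_mem_nhds (show t < b - a by linarith)] with s hs
    exact max_eq_right (by linarith [Set.mem_Iio.1 hs])
  · refine (hasDerivAt_const t a).congr_of_eventuallyEq ?_
    have : b - t < a := lt_of_le_of_ne (by linarith) h
    filter_upwards [Ioi_mem_nhds (show b - a < t by linarith)] with s hs
    exact max_eq_left (by linarith [Set.mem_Ioi.1 hs])

lemma hasDerivAt_integral_buyerSurplus {η : Measure (Fin m → ℝ)} [IsProbabilityMeasure η]
    (hη : ∀ j, Integrable (fun x : Fin m → ℝ => x j) η) (P : Fin m → ℝ) (j : Fin m)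
    (htie : ∀ᵐ x ∂η, x j - P j ≠ altSurplus P x j) :
    HasDerivAt (fun t => ∫ x, buyerSurplus (Function.update P j t) x ∂η)
      (-(η.real (favSet P j))) (P j) := by
  have hfm : MeasurableSet (favSet P j) :=
    measurableSet_favSet j |>.preimage (f := fun x => (P, x)) measurable_prodMk_left
  have hmain := hasDerivAt_integral_of_dominated_loc_of_lip (μ := η) (s := Set.univ)
    (F := fun t x => buyerSurplus (Function.update P j t) x)
    (F' := (favSet P j).indicator fun _ => -1) (x₀ := P j) (bound := fun _ => 1)
    Filter.univ_mem
    (Filter.Eventually.of_forall fun t => (integrable_buyerSurplus hη _).aestronglyMeasurable)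
    (integrable_buyerSurplus hη _)
    (measurable_const.indicator hfm).aestronglyMeasurable
    (Filter.Eventually.of_forall fun x => ?_) (integrable_const _) ?_
  · have h := hmain.2
    rw [integral_indicator_const _ hfm] at h
    simpa using h
  · refine LipschitzOnWith.of_dist_le_mul fun s _ t _ => ?_
    simp only [buyerSurplus_eq j, altSurplus_update_price, Function.update_self, Real.dist_eq]
    have := abs_max_sub_max_le_max (altSurplus P x j) (x j - s) (altSurplus P x j) (x j - t)
    rw [sub_self, abs_zero, max_eq_right (a := (0 : ℝ)) (abs_nonneg _), sub_sub_sub_cancel_left,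
      abs_sub_comm t s] at this
    simpa using this
  · filter_upwards [htie] with x hx
    simp only [buyerSurplus_eq j, altSurplus_update_price, Function.update_self]
    have hind : (favSet P j).indicator (fun _ => (-1 : ℝ)) x =
        if P j + altSurplus P x j < x j then -1 else 0 := by
      simp [Set.indicator_apply, favSet]
    rw [hind]
    exact hasDerivAt_max_sub hx

lemma ae_surplus_ne_altSurplus {η : Measure (Fin m → ℝ)} (hη : η ≪ volume) (P : Fin m → ℝ)
    (j : Fin m) : ∀ᵐ x ∂η, x j - P j ≠ altSurplus P x j := by
  refine hη.ae_le ?_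
  have h0 : ∀ᵐ x : Fin m → ℝ, x j ≠ P j :=
    Measure.ae_eval_ne (μ := fun _ : Fin m => (volume : Measure ℝ)) j (P j)
  have h1 : ∀ j', j' ≠ j → ∀ᵐ x : Fin m → ℝ, x j - P j ≠ x j' - P j' := fun j' hj' => by
    set L : (Fin m → ℝ) →ₗ[ℝ] ℝ := LinearMap.proj (R := ℝ) (φ := fun _ => ℝ) j -
      LinearMap.proj (R := ℝ) (φ := fun _ => ℝ) j' with hL
    have hmem : ∀ x, x ∈ AffineSubspace.mk' P (LinearMap.ker L) ↔ x j - P j = x j' - P j' := by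
      intro x
      rw [AffineSubspace.mem_mk', LinearMap.mem_ker]
      simp [hL, sub_eq_zero]
    have hnull := Measure.addHaar_affineSubspace volume (AffineSubspace.mk' P (LinearMap.ker L))
      fun h => by
        have := (hmem (Function.update P j (P j + 1))).1 (h ▸ AffineSubspace.mem_top ℝ _ _)
        simp [hj'] at this
    rw [ae_iff]
    convert hnull using 2
    ext x
    simpa using (hmem x).symm
  have h1' : ∀ᵐ x : Fin m → ℝ, ∀ j', j' ≠ j → x j - P j ≠ x j' - P j' := by
    rw [ae_all_iff]
    intro j'
    by_cases h : j' = j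
    · exact Filter.Eventually.of_forall fun x hx => absurd h hx
    · filter_upwards [h1 j' h] with x hx _ using hx
  filter_upwards [h0, h1'] with x hx0 hx1 heq
  rcases altSurplus_eq_zero_or P x j with h | ⟨j', hj', h⟩
  · exact hx0 (by linarith)
  · exact hx1 j' hj' (by linarith)

lemma exists_clearing_price {n : ℕ} (η : Fin n → Measure (Fin m → ℝ))
    [∀ i, IsProbabilityMeasure (η i)]
    (hη : ∀ i j, Integrable (fun x : Fin m → ℝ => x j) (η i)) (hac : ∀ i, η i ≪ volume)
    {k : Fin m → ℝ} (hk : ∀ j, 1 ≤ k j) :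
    ∃ P : Fin m → ℝ, (∀ j, 0 ≤ P j) ∧ (∀ j, ∑ i, (η i).real (favSet P j) ≤ k j) ∧
      ∀ j, 0 < P j → ∑ i, (η i).real (favSet P j) = k j := by
  set Φ : (Fin m → ℝ) → ℝ := fun P => ∑ j, k j * P j + ∑ i, ∫ x, buyerSurplus P x ∂(η i)
    with hΦ
  have hcont : Continuous Φ := by
    refine (by fun_prop : Continuous fun P : Fin m → ℝ => ∑ j, k j * P j).add
      (continuous_finsetSum _ fun i _ => ?_)
    refine (LipschitzWith.of_le_add fun P P' => ?_).continuous
    calc ∫ x, buyerSurplus P x ∂(η i) ≤ ∫ x, (buyerSurplus P' x + dist P P') ∂(η i) :=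
          integral_mono (integrable_buyerSurplus (hη i) P)
            ((integrable_buyerSurplus (hη i) P').add (integrable_const _))
            fun x => buyerSurplus_le_add_dist P P' x
      _ = _ := by
          rw [integral_add (integrable_buyerSurplus (hη i) P') (integrable_const _)]
          simp
  set C : ℝ := Φ 0 + 1 with hC
  have hlow : ∀ P : Fin m → ℝ, (∀ j, 0 ≤ P j) → ∀ j, P j ≤ Φ P := fun P hP j => by
    have h1 : P j ≤ ∑ j, k j * P j :=
      calc P j ≤ k j * P j := le_mul_of_one_le_left (hP j) (hk j)
        _ ≤ _ := Finset.single_le_sum (f := fun j => k j * P j)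
          (fun j _ => mul_nonneg (by linarith [hk j]) (hP j)) (Finset.mem_univ j)
    have h2 : 0 ≤ ∑ i, ∫ x, buyerSurplus P x ∂(η i) :=
      Finset.sum_nonneg fun i _ => integral_nonneg fun x => buyerSurplus_nonneg
    simp only [hΦ]
    linarith
  have hΦ0 : 0 ≤ Φ 0 := by
    simp only [hΦ, Pi.zero_apply, mul_zero, Finset.sum_const_zero, zero_add]
    exact Finset.sum_nonneg fun i _ => integral_nonneg fun x => buyerSurplus_nonneg
  have hzero : (0 : Fin m → ℝ) ∈ Set.Icc (0 : Fin m → ℝ) fun _ => C :=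
    ⟨le_rfl, fun j => by simp only [Pi.zero_apply]; linarith⟩
  obtain ⟨P, hPmem, hPmin⟩ := isCompact_Icc.exists_isMinOn ⟨0, hzero⟩ hcont.continuousOn
  have hP0 : ∀ j, 0 ≤ P j := hPmem.1
  have hPC : ∀ j, P j < C := fun j => by
    have h1 := hlow P hP0 j
    have h2 : Φ P ≤ Φ 0 := hPmin hzero
    linarith
  have hmin : ∀ j, ∀ t ∈ Set.Icc 0 C, Φ P ≤ Φ (Function.update P j t) := fun j t ht => by
    refine hPmin ⟨fun i => ?_, fun i => ?_⟩ <;> rcases eq_or_ne i j with rfl | h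
    · simpa using ht.1
    · simpa [h] using hP0 i
    · simpa using ht.2
    · simpa [h] using (hPC i).le
  have hder : ∀ j, HasDerivAt (fun t => Φ (Function.update P j t))
      (k j - ∑ i, (η i).real (favSet P j)) (P j) := fun j => by
    have h1 : HasDerivAt (fun t => ∑ j', k j' * Function.update P j t j') (k j) (P j) := by
      have : ∀ t, ∑ j', k j' * Function.update P j t j' =
          k j * t + ∑ j' ∈ Finset.univ.erase j, k j' * P j' := fun t => by
        rw [← Finset.add_sum_erase _ _ (Finset.mem_univ j), Function.update_self]
        congr 1
        refine Finset.sum_congr rfl fun j' hj' => ?_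
        rw [Function.update_of_ne (Finset.ne_of_mem_erase hj')]
      simp only [this]
      simpa using ((hasDerivAt_id (P j)).const_mul (k j)).add_const
        (∑ j' ∈ Finset.univ.erase j, k j' * P j')
    have h2 := HasDerivAt.fun_sum (u := Finset.univ) fun i _ =>
      hasDerivAt_integral_buyerSurplus (hη i) P j (ae_surplus_ne_altSurplus (hac i) P j)
    rw [Finset.sum_neg_distrib] at h2
    exact h1.add h2
  refine ⟨P, hP0, fun j => ?_, fun j hj => ?_⟩
  · rw [← sub_nonneg]
    have hs := (hasDerivAt_iff_tendsto_slope_left_right.1 (hder j)).2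
    refine ge_of_tendsto hs ?_
    filter_upwards [Ioo_mem_nhdsGT (hPC j)] with t ht
    have := hmin j t ⟨(hP0 j).trans ht.1.le, ht.2.le⟩
    rw [slope_def_field, Function.update_eq_self]
    exact div_nonneg (by linarith) (by linarith [ht.1])
  · have hloc : IsLocalMin (fun t => Φ (Function.update P j t)) (P j) := by
      filter_upwards [Icc_mem_nhds hj (hPC j)] with t ht
      rw [Function.update_eq_self]
      exact hmin j t ht
    have := hloc.hasDerivAt_eq_zero (hder j)
    linarith

end ClearingPrice

section NoisyPrice

variable {m : ℕ} {P r x : Fin m → ℝ} {j : Fin m}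

lemma altSurplus_add : altSurplus (P + r) x j = altSurplus P (x - r) j := by
  unfold altSurplus
  congr 1
  refine Finset.sup_congr rfl fun j' _ => ?_
  rw [Pi.add_apply, Pi.sub_apply, sub_add_eq_sub_sub_swap]

lemma mem_favSet_add : x ∈ favSet (P + r) j ↔ x - r ∈ favSet P j := by
  simp only [favSet, Set.mem_ofPred_eq, altSurplus_add, Pi.add_apply, Pi.sub_apply]
  constructor <;> intro h <;> linarith

/-- The uniform distribution on the unit cube. -/
noncomputable def cubeMeasure (m : ℕ) : Measure (Fin m → ℝ) := volume.restrict (Set.Icc 0 1)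

instance : IsProbabilityMeasure (cubeMeasure m) := by
  constructor
  simp [cubeMeasure, Real.volume_Icc_pi]

lemma ae_cubeMeasure : ∀ᵐ u ∂(cubeMeasure m), ∀ j, 0 ≤ u j ∧ u j ≤ 1 := by
  filter_upwards [ae_restrict_mem (measurableSet_Icc (a := (0 : Fin m → ℝ)) (b := 1))] with u hu j
  exact ⟨hu.1 j, hu.2 j⟩

lemma measurableSet_noisy_favSet (P : Fin m → ℝ) (ε : ℝ) (j : Fin m) :
    MeasurableSet {z : (Fin m → ℝ) × (Fin m → ℝ) | z.2 ∈ favSet (P + ε • z.1) j} :=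
  (measurableSet_favSet j).preimage
    (f := fun z : (Fin m → ℝ) × (Fin m → ℝ) => (P + ε • z.1, z.2)) (by fun_prop)

lemma measurable_noisy_altSurplus (P : Fin m → ℝ) (ε : ℝ) (j : Fin m) :
    Measurable fun z : (Fin m → ℝ) × (Fin m → ℝ) => altSurplus (P + ε • z.1) z.2 j :=
  (continuous_altSurplus j).measurable.comp
    (g := fun z : (Fin m → ℝ) × (Fin m → ℝ) => altSurplus z.1 z.2 j)
    (f := fun z : (Fin m → ℝ) × (Fin m → ℝ) => (P + ε • z.1, z.2)) (by fun_prop)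

lemma exists_noisy_clearing_price {n : ℕ} (ν : Fin n → Measure (Fin m → ℝ))
    [∀ i, IsProbabilityMeasure (ν i)]
    (hν : ∀ i j, Integrable (fun x : Fin m → ℝ => x j) (ν i)) {k : Fin m → ℕ}
    (hk : ∀ j, 1 ≤ k j) {ε : ℝ} (hε : 0 < ε) :
    ∃ P : Fin m → ℝ, (∀ j, 0 ≤ P j) ∧
      (∀ j, ∑ i, ((cubeMeasure m).prod (ν i)) {z | z.2 ∈ favSet (P + ε • z.1) j} ≤ k j) ∧
      (∀ j, k j * ENNReal.ofReal (P j) ≤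
        ∑ i, ENNReal.ofReal (P j) *
          ((cubeMeasure m).prod (ν i)) {z | z.2 ∈ favSet (P + ε • z.1) j}) ∧
      ∀ i, ∀ᵐ z ∂((cubeMeasure m).prod (ν i)), ∀ j,
        z.2 j - (P + ε • z.1) j ≠ altSurplus (P + ε • z.1) z.2 j := by
  set T : (Fin m → ℝ) × (Fin m → ℝ) → Fin m → ℝ := fun z => z.2 - ε • z.1 with hT
  have hTm : Measurable T := by fun_prop
  set η : Fin n → Measure (Fin m → ℝ) := fun i => ((cubeMeasure m).prod (ν i)).map T with hη
  have hprob : ∀ i, IsProbabilityMeasure (η i) := fun i =>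
    Measure.isProbabilityMeasure_map hTm.aemeasurable
  have hqint : ∀ i j, Integrable (fun x : Fin m → ℝ => x j) (η i) := fun i j => by
    rw [integrable_map_measure (measurable_pi_apply j).aestronglyMeasurable hTm.aemeasurable]
    have h1 : Integrable (fun z : (Fin m → ℝ) × (Fin m → ℝ) => z.2 j)
        ((cubeMeasure m).prod (ν i)) := (hν i j).comp_snd _
    have h2 : Integrable (fun u : Fin m → ℝ => u j) (cubeMeasure m) := by
      refine Integrable.mono' (integrable_const (1 : ℝ))
        (measurable_pi_apply j).aestronglyMeasurable ?_
      filter_upwards [ae_cubeMeasure] with u hu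
      rw [Real.norm_of_nonneg (hu j).1]
      exact (hu j).2
    exact h1.sub ((h2.comp_fst _).const_mul ε)
  have hac : ∀ i, η i ≪ volume := fun i => by
    refine Measure.AbsolutelyContinuous.mk fun s hs h0 => ?_
    rw [Measure.map_apply hTm hs, Measure.prod_apply_symm (measurableSet_preimage hTm hs)]
    refine (lintegral_congr fun x => ?_).trans lintegral_zero
    refine le_antisymm ((Measure.restrict_apply_le _ _).trans (le_of_eq ?_)) zero_le
    change volume ((fun u : Fin m → ℝ => ε • u) ⁻¹' ((fun w => x - w) ⁻¹' s)) = 0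
    have hsub := Measure.measurePreserving_sub_left (volume : Measure (Fin m → ℝ)) x
    rw [Measure.addHaar_preimage_smul volume hε.ne',
      hsub.measure_preimage hs.nullMeasurableSet, h0, mul_zero]
  have hfm : ∀ P j, MeasurableSet (favSet (m := m) P j) := fun P j =>
    (measurableSet_favSet j).preimage (f := fun x => (P, x)) measurable_prodMk_left
  obtain ⟨P, hP0, hle, heq⟩ := exists_clearing_price η hqint hac (k := fun j => k j)
    fun j => by exact_mod_cast hk j
  have hmeas : ∀ i j, ((cubeMeasure m).prod (ν i)) {z | z.2 ∈ favSet (P + ε • z.1) j} =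
      η i (favSet P j) := fun i j => by
    rw [Measure.map_apply hTm (hfm P j)]
    congr 1
    ext z
    exact mem_favSet_add
  have hreal : ∀ j, ∑ i, η i (favSet P j) = ENNReal.ofReal (∑ i, (η i).real (favSet P j)) :=
    fun j => by
      rw [ENNReal.ofReal_sum_of_nonneg fun i _ => measureReal_nonneg]
      exact Finset.sum_congr rfl fun i _ => (ofReal_measureReal (measure_ne_top _ _)).symm
  refine ⟨P, hP0, fun j => ?_, fun j => ?_, fun i => ?_⟩
  · simp only [hmeas, hreal]
    exact (ENNReal.ofReal_le_ofReal (hle j)).trans_eq (ENNReal.ofReal_natCast _)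
  · simp only [hmeas]
    rcases (hP0 j).eq_or_lt with h | h
    · simp [← h]
    · rw [← Finset.mul_sum, hreal, heq j h, ENNReal.ofReal_natCast, mul_comm]
  · have h := ae_all_iff.2 fun j => ae_surplus_ne_altSurplus (hac i) P j
    filter_upwards [ae_of_ae_map hTm.aemeasurable h] with z hz j
    rw [altSurplus_add]
    have := hz j
    simp only [hT, Pi.sub_apply] at this
    rwa [Pi.add_apply, sub_add_eq_sub_sub_swap]

end NoisyPrice

section LotteryMechanism

variable {n m : ℕ} {k : Fin m → ℕ} {F : Fin n → Fin m → Measure ℝ}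
  {menu : Fin n → (Fin n → Fin m → ℝ) → Set (Lottery m)}
  {q : (Fin n → Fin m → ℝ) → Fin n → Fin m → ℝ} {p : (Fin n → Fin m → ℝ) → Fin n → ℝ}
  {v : Fin n → Fin m → ℝ}

lemma copiesSup_nonneg : 0 ≤ copiesSup k F := by
  refine Real.sSup_nonneg ?_
  rintro r ⟨X, pay, h, rfl⟩
  exact integral_nonneg fun v => Finset.sum_nonneg fun e _ => h.pay_nonneg v e

lemma IsLotteryMech.q_nonneg (h : IsLotteryMech n m k menu q p) (hv : ∀ i j, 0 ≤ v i j)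
    (i : Fin n) (j : Fin m) : 0 ≤ q v i j := by
  rcases h.choice v hv i with ⟨ℓ, -, hq, -⟩ | ⟨hq, -⟩
  · rw [← hq]; exact ℓ.q_nonneg j
  · simp [hq]

lemma IsLotteryMech.q_sum_le_one (h : IsLotteryMech n m k menu q p) (hv : ∀ i j, 0 ≤ v i j)
    (i : Fin n) : ∑ j, q v i j ≤ 1 := by
  rcases h.choice v hv i with ⟨ℓ, -, hq, -⟩ | ⟨hq, -⟩
  · rw [← hq]; exact ℓ.q_sum_le_one
  · simp [hq]

lemma IsLotteryMech.p_nonneg (h : IsLotteryMech n m k menu q p) (hv : ∀ i j, 0 ≤ v i j)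
    (i : Fin n) : 0 ≤ p v i := by
  rcases h.choice v hv i with ⟨ℓ, -, -, hp, -⟩ | ⟨-, hp, -⟩
  · rw [← hp]; exact ℓ.p_nonneg
  · rw [hp]

lemma IsLotteryMech.ir (h : IsLotteryMech n m k menu q p) (hv : ∀ i j, 0 ≤ v i j)
    (i : Fin n) : 0 ≤ (∑ j, q v i j * v i j) - p v i := by
  rcases h.choice v hv i with ⟨ℓ, -, hq, hp, hu, -⟩ | ⟨hq, hp, -⟩
  · rwa [Lottery.util, hq, hp] at hu
  · simp [hq, hp]

lemma IsLotteryMech.ic (h : IsLotteryMech n m k menu q p) {w : Fin n → Fin m → ℝ}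
    (hv : ∀ i j, 0 ≤ v i j) (hw : ∀ i j, 0 ≤ w i j) (i : Fin n)
    (hvw : ∀ i', i' ≠ i → v i' = w i') :
    (∑ j, q w i j * v i j) - p w i ≤ (∑ j, q v i j * v i j) - p v i := by
  rcases h.choice w hw i with ⟨ℓ, hℓ, hq, hp, -⟩ | ⟨hq, hp, -⟩
  · rw [← h.menu_indep i v w hvw] at hℓ
    rw [← hq, ← hp]
    rcases h.choice v hv i with ⟨ℓ', -, hq', hp', -, hmax⟩ | ⟨hq', hp', hmax⟩
    · rw [← hq', ← hp']
      exact hmax ℓ hℓ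
    · simpa [hq', hp', Lottery.util] using hmax ℓ hℓ
  · simpa [hq, hp] using h.ir hv i

lemma matchRank_column_le (j : Fin m) :
    matchRank n m k (Finset.univ.filter fun e => e.2 = j) ≤ k j := by
  refine csSup_le ⟨0, ∅, by simp [IsMatching]⟩ ?_
  rintro c ⟨M, hM, hmatch, rfl⟩
  refine (le_of_eq ?_).trans (hmatch.2 j)
  rw [Finset.filter_true_of_mem fun e he => (Finset.mem_filter.1 (hM he)).2]

lemma IsLotteryMech.sum_q_le (h : IsLotteryMech n m k menu q p) (v : Fin n → Fin m → ℝ)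
    (j : Fin m) : ∑ i, q v i j ≤ k j := by
  refine le_trans (le_of_eq ?_) ((h.feas v (Finset.univ.filter fun e => e.2 = j)).trans
    (Nat.cast_le.2 (matchRank_column_le j)))
  rw [Finset.sum_filter, Fintype.sum_prod_type]
  simp

end LotteryMechanism

lemma lintegral_lintegral_update {ι α : Type*} [Fintype ι] [DecidableEq ι] [MeasurableSpace α]
    {μ : ι → Measure α} [∀ i, IsProbabilityMeasure (μ i)] {f : (ι → α) → ENNReal}
    (hf : Measurable f) (i : ι) :
    ∫⁻ v, ∫⁻ x, f (Function.update v i x) ∂(μ i) ∂(Measure.pi μ) = ∫⁻ v, f v ∂(Measure.pi μ) := by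
  have hg : (fun v => ∫⁻ x, f (Function.update v i x) ∂(μ i)) = ∫⋯∫⁻_{i}, f ∂μ := by
    rw [lmarginal_singleton]
  rw [hg]
  refine lintegral_eq_of_lmarginal_eq {i} (hf.lmarginal μ) hf ?_
  rw [lmarginal_singleton (∫⋯∫⁻_{i}, f ∂μ), lmarginal_singleton f]
  ext v
  simp

section Comparison

variable {n m : ℕ} {k : Fin m → ℕ} {F : Fin n → Fin m → Measure ℝ}
  {P : Fin m → ℝ} {ε : ℝ}

lemma le_thresholdPay_favSet {ρ x : Fin m → ℝ} {j : Fin m} :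
    (favSet ρ j).indicator (fun x => ENNReal.ofReal (ρ j + altSurplus ρ x j)) x ≤
      thresholdPay (favSet ρ j) j x := by
  by_cases hx : x ∈ favSet ρ j
  · rw [Set.indicator_of_mem hx]
    calc ENNReal.ofReal (ρ j + altSurplus ρ x j)
        = volume (Set.Ioc 0 (ρ j + altSurplus ρ x j)) := by simp
      _ ≤ thresholdPay (favSet ρ j) j x := measure_mono fun t ht => show _ ∧ _ from
          ⟨ht.1, ht.2.trans_lt hx, hx, fun h =>
            absurd (update_mem_favSet_iff.1 h) (not_lt.2 ht.2)⟩
  · rw [Set.indicator_of_notMem hx]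
    exact zero_le

lemma update_mem_favSet_of_le {ρ x : Fin m → ℝ} {j : Fin m} {t : ℝ} (hx : x ∈ favSet ρ j)
    (ht : x j ≤ t) : Function.update x j t ∈ favSet ρ j :=
  update_mem_favSet_iff.2 (lt_of_lt_of_le hx ht)

lemma update_nonneg_of_le {x : Fin m → ℝ} {j : Fin m} {t : ℝ} (hx : ∀ i, 0 ≤ x i)
    (ht : x j ≤ t) (i : Fin m) : 0 ≤ Function.update x j t i := by
  rcases eq_or_ne i j with rfl | h
  · simpa using (hx i).trans ht
  · simpa [h] using hx i

lemma sum_lintegral_favSet_le [∀ i j, IsProbabilityMeasure (F i j)]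
    (hk : ∀ j, 1 ≤ k j)
    (hF_nonneg : ∀ i j, F i j (Set.Iio 0) = 0) (hF_mean : ∀ i j, Integrable id (F i j))
    (hε : 0 ≤ ε) (hP : ∀ j, 0 ≤ P j)
    (hD : ∀ j, ∑ i, ((cubeMeasure m).prod (Measure.pi fun j => F i j))
      {z | z.2 ∈ favSet (P + ε • z.1) j} ≤ k j) :
    (∑ i, ∑ j, ENNReal.ofReal (P j) * ((cubeMeasure m).prod (Measure.pi fun j => F i j))
      {z | z.2 ∈ favSet (P + ε • z.1) j}) +
    (∑ i, ∑ j, ∫⁻ z, {z : (Fin m → ℝ) × (Fin m → ℝ) | z.2 ∈ favSet (P + ε • z.1) j}.indicator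
      (fun z => ENNReal.ofReal (altSurplus (P + ε • z.1) z.2 j)) z
      ∂((cubeMeasure m).prod (Measure.pi fun j => F i j))) ≤
      2 * ENNReal.ofReal (copiesSup k F) := by
  refine le_trans ?_ (sum_lintegral_thresholdPay_le (k := k) (F := F) (cubeMeasure m) hk hF_nonneg
    hF_mean (C := fun _ j => {z | z.2 ∈ favSet (P + ε • z.1) j})
    (W := fun _ j => {z | z.2 ∈ favSet (P + ε • z.1) j})
    (fun i j => measurableSet_noisy_favSet P ε j) (fun i j => measurableSet_noisy_favSet P ε j)
    (fun i j => subset_rfl) (fun i j j' z h h' => favSet_disjoint h h')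
    (fun i j z hz t ht => update_mem_favSet_of_le hz ht) hD)
  simp only [← Finset.sum_add_distrib]
  refine Finset.sum_le_sum fun i _ => Finset.sum_le_sum fun j _ => ?_
  have hm := measurableSet_noisy_favSet P ε j
  rw [← lintegral_indicator_const hm, ← lintegral_add_left (measurable_const.indicator hm)]
  have hu : ∀ᵐ z ∂((cubeMeasure m).prod (Measure.pi fun j => F i j)), 0 ≤ z.1 j :=
    Measure.quasiMeasurePreserving_fst.ae
      (ae_cubeMeasure.mono fun u hu => (hu j).1)
  refine lintegral_mono_ae ?_
  filter_upwards [hu] with z hz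
  refine le_trans ?_ (le_thresholdPay_favSet (ρ := P + ε • z.1) (x := z.2) (j := j))
  by_cases hx : z.2 ∈ favSet (P + ε • z.1) j
  · rw [Set.indicator_of_mem hx, Set.indicator_of_mem (by exact hx),
      Set.indicator_of_mem (by exact hx), ← ENNReal.ofReal_add (hP j) altSurplus_nonneg]
    refine ENNReal.ofReal_le_ofReal (add_le_add_left ?_ _)
    simpa using mul_nonneg hε hz
  · rw [Set.indicator_of_notMem (by exact hx), Set.indicator_of_notMem (by exact hx)]
    simp

/-- The set of noise and valuation pairs at which `j` is the favourite item and a buyer with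
allocation rule `Q` wins item `j` with probability larger than `y`. -/
def layerSet (P : Fin m → ℝ) (ε : ℝ) (Q : (Fin m → ℝ) → Fin m → ℝ) (y : ℝ) (j : Fin m) :
    Set ((Fin m → ℝ) × (Fin m → ℝ)) :=
  {z | z.2 ∈ favSet (P + ε • z.1) j ∩ {w | (∀ i, 0 ≤ w i) ∧ y < Q w j}}

lemma measurableSet_layer {Q : (Fin m → ℝ) → Fin m → ℝ} {j : Fin m}
    (hQ : Measurable fun x => Q x j) :
    MeasurableSet {a : (ℝ × (Fin m → ℝ)) × (Fin m → ℝ) |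
      (a.1.2, a.2) ∈ layerSet P ε Q a.1.1 j} := by
  have h1 : MeasurableSet {a : (ℝ × (Fin m → ℝ)) × (Fin m → ℝ) |
      a.2 ∈ favSet (P + ε • a.1.2) j} :=
    (measurableSet_noisy_favSet P ε j).preimage
      (f := fun a : (ℝ × (Fin m → ℝ)) × (Fin m → ℝ) => (a.1.2, a.2)) (by fun_prop)
  have h2 : MeasurableSet {a : (ℝ × (Fin m → ℝ)) × (Fin m → ℝ) | ∀ i, 0 ≤ a.2 i} := by
    rw [Set.ofPred_forall]
    exact MeasurableSet.iInter fun i => measurableSet_le measurable_const (by fun_prop)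
  exact h1.inter (h2.inter (measurableSet_lt (by fun_prop) (hQ.comp measurable_snd)))

lemma sum_lintegral_layer_le [∀ i j, IsProbabilityMeasure (F i j)]
    (hk : ∀ j, 1 ≤ k j)
    (hF_nonneg : ∀ i j, F i j (Set.Iio 0) = 0) (hF_mean : ∀ i j, Integrable id (F i j))
    (hD : ∀ j, ∑ i, ((cubeMeasure m).prod (Measure.pi fun j => F i j))
      {z | z.2 ∈ favSet (P + ε • z.1) j} ≤ k j)
    {Q : Fin n → (Fin m → ℝ) → Fin m → ℝ} (hQ : ∀ i j, Measurable fun x => Q i x j)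
    (hmono : ∀ i j x, (∀ j, 0 ≤ x j) → ∀ t, x j ≤ t → Q i x j ≤ Q i (Function.update x j t) j) :
    ∑ i, ∑ j, ∫⁻ z, (∫⁻ y in Set.Ioo (0 : ℝ) 1,
        thresholdPay {w | (z.1, w) ∈ layerSet P ε (Q i) y j} j z.2)
        ∂((cubeMeasure m).prod (Measure.pi fun j => F i j)) ≤
      2 * ENNReal.ofReal (copiesSup k F) := by
  have hmeas : ∀ i j, Measurable fun a : ((Fin m → ℝ) × (Fin m → ℝ)) × ℝ =>
      thresholdPay {w | (a.1.1, w) ∈ layerSet P ε (Q i) a.2 j} j a.1.2 := fun i j =>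
    (measurable_thresholdPay (measurableSet_layer (P := P) (ε := ε) (hQ i j)) j).comp
      (f := fun a : ((Fin m → ℝ) × (Fin m → ℝ)) × ℝ => ((a.2, a.1.1), a.1.2)) (by fun_prop)
  have hswap : ∀ i j, ∫⁻ z, (∫⁻ y in Set.Ioo (0 : ℝ) 1,
        thresholdPay {w | (z.1, w) ∈ layerSet P ε (Q i) y j} j z.2)
        ∂((cubeMeasure m).prod (Measure.pi fun j => F i j)) =
      ∫⁻ y in Set.Ioo (0 : ℝ) 1, ∫⁻ z,
        thresholdPay {w | (z.1, w) ∈ layerSet P ε (Q i) y j} j z.2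
        ∂((cubeMeasure m).prod (Measure.pi fun j => F i j)) := fun i j =>
    lintegral_lintegral_swap (hmeas i j).aemeasurable
  have hinner : ∀ i j, Measurable fun y : ℝ => ∫⁻ z,
        thresholdPay {w | (z.1, w) ∈ layerSet P ε (Q i) y j} j z.2
        ∂((cubeMeasure m).prod (Measure.pi fun j => F i j)) := fun i j =>
    (hmeas i j).lintegral_prod_left'
  simp only [hswap]
  calc _ = ∫⁻ y in Set.Ioo (0 : ℝ) 1, ∑ i, ∑ j, ∫⁻ z,
        thresholdPay {w | (z.1, w) ∈ layerSet P ε (Q i) y j} j z.2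
        ∂((cubeMeasure m).prod (Measure.pi fun j => F i j)) := by
        rw [lintegral_finsetSum _ fun i _ => Finset.measurable_sum _ fun j _ => hinner i j]
        exact Finset.sum_congr rfl fun i _ => (lintegral_finsetSum _ fun j _ => hinner i j).symm
    _ ≤ ∫⁻ y in Set.Ioo (0 : ℝ) 1, 2 * ENNReal.ofReal (copiesSup k F) := by
        refine lintegral_mono fun y => ?_
        refine sum_lintegral_thresholdPay_le (k := k) (F := F) (cubeMeasure m) hk hF_nonneg
          hF_mean (C := fun _ j => {z | z.2 ∈ favSet (P + ε • z.1) j})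
          (W := fun i j => layerSet P ε (Q i) y j)
          (fun i j => measurableSet_noisy_favSet P ε j) (fun i j => ?_)
          (fun i j z hz => hz.1) (fun i j j' z h h' => favSet_disjoint h h')
          (fun i j z hz t ht => ?_) hD
        · exact (measurableSet_layer (P := P) (ε := ε) (hQ i j)).preimage
            (f := fun z : (Fin m → ℝ) × (Fin m → ℝ) => ((y, z.1), z.2)) (by fun_prop)
        · exact ⟨update_mem_favSet_of_le hz.1 ht, update_nonneg_of_le hz.2.1 ht,
            hz.2.2.trans_le (hmono i j z.2 hz.2.1 t ht)⟩
    _ = _ := by simp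

end Comparison

section LotteryRevenue

variable {n m : ℕ} {k : Fin m → ℕ} {F : Fin n → Fin m → Measure ℝ}
  {P : Fin m → ℝ} {ε : ℝ}

lemma lintegral_lottery_price_le {ν : Measure (Fin m → ℝ)} [IsProbabilityMeasure ν]
    (hν : ∀ᵐ x ∂ν, ∀ j, 0 ≤ x j) (hε : 0 ≤ ε) (hP : ∀ j, 0 ≤ P j)
    (htie : ∀ᵐ z ∂((cubeMeasure m).prod ν), ∀ j,
        z.2 j - (P + ε • z.1) j ≠ altSurplus (P + ε • z.1) z.2 j)
    {Q : (Fin m → ℝ) → Fin m → ℝ} {p : (Fin m → ℝ) → ℝ} (hp : Measurable p)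
    (hQm : ∀ j, Measurable fun x => Q x j)
    (hQ0 : ∀ x, (∀ j, 0 ≤ x j) → ∀ j, 0 ≤ Q x j)
    (hQ1 : ∀ x, (∀ j, 0 ≤ x j) → ∑ j, Q x j ≤ 1)
    (hir : ∀ x, (∀ j, 0 ≤ x j) → 0 ≤ (∑ j, Q x j * x j) - p x)
    (hic : ∀ x w, (∀ j, 0 ≤ x j) → (∀ j, 0 ≤ w j) →
      (∑ j, Q w j * x j) - p w ≤ (∑ j, Q x j * x j) - p x) :
    ∫⁻ x, ENNReal.ofReal (p x) ∂ν ≤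
      (∑ j, ∫⁻ z, (∫⁻ y in Set.Ioo (0 : ℝ) 1,
        thresholdPay {w | (z.1, w) ∈ layerSet P ε Q y j} j z.2) ∂((cubeMeasure m).prod ν)) +
      (∑ j, ∫⁻ z, {z : (Fin m → ℝ) × (Fin m → ℝ) | z.2 ∈ favSet (P + ε • z.1) j}.indicator
        (fun z => ENNReal.ofReal (altSurplus (P + ε • z.1) z.2 j)) z
        ∂((cubeMeasure m).prod ν)) +
      ∑ j, ENNReal.ofReal (P j + ε) * ∫⁻ x, ENNReal.ofReal (Q x j) ∂ν := by
  have hfst : ∫⁻ x, ENNReal.ofReal (p x) ∂ν =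
      ∫⁻ z, ENNReal.ofReal (p z.2) ∂((cubeMeasure m).prod ν) :=
    (measurePreserving_snd.lintegral_comp hp.ennreal_ofReal).symm
  have hQsnd : ∀ j, ∫⁻ x, ENNReal.ofReal (Q x j) ∂ν =
      ∫⁻ z, ENNReal.ofReal (Q z.2 j) ∂((cubeMeasure m).prod ν) := fun j =>
    (measurePreserving_snd.lintegral_comp (hQm j).ennreal_ofReal).symm
  have hm1 : ∀ j, Measurable fun z : (Fin m → ℝ) × (Fin m → ℝ) =>
      ∫⁻ y in Set.Ioo (0 : ℝ) 1, thresholdPay {w | (z.1, w) ∈ layerSet P ε Q y j} j z.2 :=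
    fun j => Measurable.lintegral_prod_right'
      (f := fun a : ((Fin m → ℝ) × (Fin m → ℝ)) × ℝ =>
        thresholdPay {w | (a.1.1, w) ∈ layerSet P ε Q a.2 j} j a.1.2)
      ((measurable_thresholdPay (measurableSet_layer (P := P) (ε := ε) (hQm j)) j).comp
        (f := fun a : ((Fin m → ℝ) × (Fin m → ℝ)) × ℝ => ((a.2, a.1.1), a.1.2)) (by fun_prop))
  have hm2 : ∀ j, Measurable
      ({z : (Fin m → ℝ) × (Fin m → ℝ) | z.2 ∈ favSet (P + ε • z.1) j}.indicator
        fun z => ENNReal.ofReal (altSurplus (P + ε • z.1) z.2 j)) := fun j =>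
    (measurable_noisy_altSurplus P ε j).ennreal_ofReal.indicator (measurableSet_noisy_favSet P ε j)
  have hm3 : ∀ j, Measurable fun z : (Fin m → ℝ) × (Fin m → ℝ) =>
      ENNReal.ofReal (Q z.2 j) := fun j => ((hQm j).comp measurable_snd).ennreal_ofReal
  have hm12 : Measurable fun z : (Fin m → ℝ) × (Fin m → ℝ) =>
      (∑ j, ∫⁻ y in Set.Ioo (0 : ℝ) 1, thresholdPay {w | (z.1, w) ∈ layerSet P ε Q y j} j z.2) +
        ∑ j, Set.indicator {z : (Fin m → ℝ) × (Fin m → ℝ) | z.2 ∈ favSet (P + ε • z.1) j}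
          (fun z : (Fin m → ℝ) × (Fin m → ℝ) =>
            ENNReal.ofReal (altSurplus (P + ε • z.1) z.2 j)) z :=
    (Finset.measurable_sum _ fun j _ => hm1 j).add (Finset.measurable_sum _ fun j _ => hm2 j)
  rw [hfst]
  simp only [hQsnd]
  rw [← lintegral_finsetSum _ fun j _ => hm1 j, ← lintegral_finsetSum _ fun j _ => hm2 j]
  simp only [← lintegral_const_mul _ (hm3 _)]
  rw [← lintegral_finsetSum _ fun j _ => (hm3 j).const_mul _,
    ← lintegral_add_left (Finset.measurable_sum _ fun j _ => hm1 j),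
    ← lintegral_add_left hm12]
  refine lintegral_mono_ae ?_
  filter_upwards [htie, Measure.quasiMeasurePreserving_fst.ae ae_cubeMeasure,
    Measure.quasiMeasurePreserving_snd.ae hν] with z hz hu hx
  have hρ0 : ∀ j, 0 ≤ (P + ε • z.1) j := fun j =>
    add_nonneg (hP j) (mul_nonneg hε (hu j).1)
  have hρle : ∀ j, (P + ε • z.1) j ≤ P j + ε := fun j => by
    have := mul_le_of_le_one_right hε (hu j).2
    simpa using this
  have hlast : ∑ j, ENNReal.ofReal (Q z.2 j * (P + ε • z.1) j) ≤
      ∑ j, ENNReal.ofReal (P j + ε) * ENNReal.ofReal (Q z.2 j) :=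
    Finset.sum_le_sum fun j _ => by
      rw [← ENNReal.ofReal_mul ((hρ0 j).trans (hρle j)), mul_comm]
      exact ENNReal.ofReal_le_ofReal (mul_le_mul_of_nonneg_right (hρle j) (hQ0 _ hx j))
  refine le_trans ?_ (add_le_add le_rfl hlast)
  rcases exists_mem_favSet hz with hle | ⟨j, hj⟩
  · refine le_trans ?_ le_add_self
    rw [← ENNReal.ofReal_sum_of_nonneg fun j _ => mul_nonneg (hQ0 _ hx j) (hρ0 j)]
    refine ENNReal.ofReal_le_ofReal ((sub_nonneg.1 (hir _ hx)).trans ?_)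
    exact Finset.sum_le_sum fun j _ => mul_le_mul_of_nonneg_left (hle j) (hQ0 _ hx j)
  · refine (ofReal_price_le hρ0 hQm hQ0 hQ1 hir hic hx hj).trans ?_
    refine add_le_add (add_le_add ?_ ?_) le_rfl
    · exact Finset.single_le_sum (f := fun j => ∫⁻ y in Set.Ioo (0 : ℝ) 1,
        thresholdPay {w | (z.1, w) ∈ layerSet P ε Q y j} j z.2) (fun _ _ => zero_le)
        (Finset.mem_univ j)
    · refine le_trans (le_of_eq ?_) (Finset.single_le_sum (f := fun j =>
        {z : (Fin m → ℝ) × (Fin m → ℝ) | z.2 ∈ favSet (P + ε • z.1) j}.indicator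
        (fun z => ENNReal.ofReal (altSurplus (P + ε • z.1) z.2 j)) z) (fun _ _ => zero_le)
        (Finset.mem_univ j))
      exact (Set.indicator_of_mem (show z ∈ {z : (Fin m → ℝ) × (Fin m → ℝ) |
        z.2 ∈ favSet (P + ε • z.1) j} from hj) fun z : (Fin m → ℝ) × (Fin m → ℝ) =>
        ENNReal.ofReal (altSurplus (P + ε • z.1) z.2 j)).symm

lemma monotone_allocation {Q : (Fin m → ℝ) → Fin m → ℝ} {p : (Fin m → ℝ) → ℝ}
    (hic : ∀ x w, (∀ j, 0 ≤ x j) → (∀ j, 0 ≤ w j) →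
      (∑ j, Q w j * x j) - p w ≤ (∑ j, Q x j * x j) - p x)
    {x : Fin m → ℝ} (hx : ∀ j, 0 ≤ x j) {j : Fin m} {t : ℝ} (ht : x j ≤ t) :
    Q x j ≤ Q (Function.update x j t) j := by
  rcases ht.eq_or_lt with h | h
  · rw [← h, Function.update_eq_self]
  set w := Function.update x j t with hw
  have hw0 := update_nonneg_of_le hx ht
  have h1 := hic x w hx hw0
  have h2 := hic w x hw0 hx
  have hsum : ∀ a : Fin m → ℝ, ∑ i, a i * w i = (∑ i, a i * x i) + a j * (t - x j) := fun a => by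
    rw [← Finset.add_sum_erase _ _ (Finset.mem_univ j),
      ← Finset.add_sum_erase (a := j) _ (fun i => a i * x i) (Finset.mem_univ j), hw,
      Function.update_self, Finset.sum_congr rfl fun i hi => by
        rw [Function.update_of_ne (Finset.ne_of_mem_erase hi)]]
    ring
  rw [hsum, hsum] at h2
  have : 0 ≤ (Q w j - Q x j) * (t - x j) := by linarith
  linarith [nonneg_of_mul_nonneg_left this (sub_pos.2 h)]

lemma IsLotteryMech.sum_lintegral_price_le {menu : Fin n → (Fin n → Fin m → ℝ) → Set (Lottery m)}
    {q : (Fin n → Fin m → ℝ) → Fin n → Fin m → ℝ} {p : (Fin n → Fin m → ℝ) → Fin n → ℝ}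
    (h : IsLotteryMech n m k menu q p) [∀ i j, IsProbabilityMeasure (F i j)]
    (hk : ∀ j, 1 ≤ k j)
    (hF_nonneg : ∀ i j, F i j (Set.Iio 0) = 0) (hF_mean : ∀ i j, Integrable id (F i j))
    (hε : 0 < ε) :
    ∑ i, ∫⁻ v, ENNReal.ofReal (p v i) ∂(valMeasure F) ≤
      4 * ENNReal.ofReal (copiesSup k F) + ∑ j, k j * ENNReal.ofReal ε := by
  obtain ⟨P, hP, hD, hclear, htie⟩ := exists_noisy_clearing_price
    (fun i => Measure.pi fun j => F i j) (fun i j => integrable_pi_entry hF_mean i j) hk hε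
  have hfav := sum_lintegral_favSet_le (k := k) hk hF_nonneg hF_mean hε.le hP hD
  set S := ∑ i, ∑ j, ∫⁻ z, {z : (Fin m → ℝ) × (Fin m → ℝ) |
    z.2 ∈ favSet (P + ε • z.1) j}.indicator
      (fun z => ENNReal.ofReal (altSurplus (P + ε • z.1) z.2 j)) z
      ∂((cubeMeasure m).prod (Measure.pi fun j => F i j)) with hS
  have hupd : ∀ i, Measurable fun a : (Fin n → Fin m → ℝ) × (Fin m → ℝ) =>
      Function.update a.1 i a.2 := fun i => measurable_update'
  have hupd0 : ∀ v : Fin n → Fin m → ℝ, (∀ i j, 0 ≤ v i j) → ∀ i x, (∀ j, 0 ≤ x j) →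
      ∀ i' j, 0 ≤ Function.update v i x i' j := fun v hv i x hx i' j => by
    rcases eq_or_ne i' i with rfl | hne
    · simpa using hx j
    · simpa [hne] using hv i' j
  have hfix : ∀ v : Fin n → Fin m → ℝ, (∀ i j, 0 ≤ v i j) →
      ∑ i, ∫⁻ x, ENNReal.ofReal (p (Function.update v i x) i) ∂(Measure.pi fun j => F i j) ≤
        2 * ENNReal.ofReal (copiesSup k F) + S + ∑ i, ∑ j, ENNReal.ofReal (P j + ε) *
          ∫⁻ x, ENNReal.ofReal (q (Function.update v i x) i j)
            ∂(Measure.pi fun j => F i j) := fun v hv => by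
    have hQm : ∀ i j, Measurable fun x => q (Function.update v i x) i j := fun i j =>
      (h.measQ i j).comp ((hupd i).comp measurable_prodMk_left)
    have hic : ∀ i (x w : Fin m → ℝ), (∀ j, 0 ≤ x j) → (∀ j, 0 ≤ w j) →
        (∑ j, q (Function.update v i w) i j * x j) - p (Function.update v i w) i ≤
        (∑ j, q (Function.update v i x) i j * x j) - p (Function.update v i x) i :=
      fun i x w hx hw => by
        have := h.ic (hupd0 v hv i x hx) (hupd0 v hv i w hw) i fun i' hi' => by
          rw [Function.update_of_ne hi', Function.update_of_ne hi']
        simpa using this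
    have hlayer := sum_lintegral_layer_le (P := P) (ε := ε) hk hF_nonneg hF_mean hD
      (Q := fun i x => q (Function.update v i x) i) hQm
      fun i j x hx t ht => monotone_allocation (Q := fun x => q (Function.update v i x) i)
        (p := fun x => p (Function.update v i x) i) (hic i) hx ht
    calc _ ≤ _ := Finset.sum_le_sum fun i _ =>
          lintegral_lottery_price_le (ae_nonneg_pi hF_nonneg i) hε.le hP (htie i)
            (Q := fun x => q (Function.update v i x) i) (p := fun x => p (Function.update v i x) i)
            ((h.measP i).comp ((hupd i).comp measurable_prodMk_left)) (hQm i)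
            (fun x hx j => h.q_nonneg (hupd0 v hv i x hx) i j)
            (fun x hx => h.q_sum_le_one (hupd0 v hv i x hx) i)
            (fun x hx => by simpa using h.ir (hupd0 v hv i x hx) i) (hic i)
      _ ≤ _ := by
          rw [Finset.sum_add_distrib, Finset.sum_add_distrib]
          exact add_le_add (add_le_add hlayer le_rfl) le_rfl
  have hpm : ∀ i, Measurable fun v => ENNReal.ofReal (p v i) := fun i => (h.measP i).ennreal_ofReal
  have hqm : ∀ i j, Measurable fun v => ENNReal.ofReal (q v i j) :=
    fun i j => (h.measQ i j).ennreal_ofReal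
  have hpm' : ∀ i, Measurable fun v => ∫⁻ x, ENNReal.ofReal (p (Function.update v i x) i)
      ∂(Measure.pi fun j => F i j) := fun i => ((hpm i).comp (hupd i)).lintegral_prod_right'
  have hqm' : ∀ i j, Measurable fun v => ∫⁻ x, ENNReal.ofReal (q (Function.update v i x) i j)
      ∂(Measure.pi fun j => F i j) := fun i j => ((hqm i j).comp (hupd i)).lintegral_prod_right'
  have hcol : ∀ j, ∑ i, ∫⁻ v, ENNReal.ofReal (q v i j) ∂(valMeasure F) ≤ k j := fun j => by
    rw [← lintegral_finsetSum _ fun i _ => hqm i j]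
    calc _ ≤ ∫⁻ _, (k j : ENNReal) ∂(valMeasure F) := by
          refine lintegral_mono_ae ?_
          filter_upwards [ae_nonneg_valMeasure hF_nonneg] with v hv
          rw [← ENNReal.ofReal_sum_of_nonneg fun i _ => h.q_nonneg hv i j]
          exact (ENNReal.ofReal_le_ofReal (h.sum_q_le v j)).trans_eq (ENNReal.ofReal_natCast _)
      _ = _ := by simp
  calc ∑ i, ∫⁻ v, ENNReal.ofReal (p v i) ∂(valMeasure F)
      = ∫⁻ v, ∑ i, ∫⁻ x, ENNReal.ofReal (p (Function.update v i x) i)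
          ∂(Measure.pi fun j => F i j) ∂(valMeasure F) := by
        rw [lintegral_finsetSum _ fun i _ => hpm' i]
        exact Finset.sum_congr rfl fun i _ => (lintegral_lintegral_update (hpm i) i).symm
    _ ≤ ∫⁻ v, (2 * ENNReal.ofReal (copiesSup k F) + S + ∑ i, ∑ j, ENNReal.ofReal (P j + ε) *
          ∫⁻ x, ENNReal.ofReal (q (Function.update v i x) i j)
            ∂(Measure.pi fun j => F i j)) ∂(valMeasure F) := by
        refine lintegral_mono_ae ?_
        filter_upwards [ae_nonneg_valMeasure hF_nonneg] with v hv using hfix v hv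
    _ = 2 * ENNReal.ofReal (copiesSup k F) + S + ∑ i, ∑ j, ENNReal.ofReal (P j + ε) *
          ∫⁻ v, ENNReal.ofReal (q v i j) ∂(valMeasure F) := by
        rw [lintegral_add_left measurable_const, lintegral_const, measure_univ, mul_one,
          lintegral_finsetSum _ fun i _ => Finset.measurable_sum _ fun j _ =>
            (hqm' i j).const_mul _]
        congr 1
        refine Finset.sum_congr rfl fun i _ => ?_
        rw [lintegral_finsetSum _ fun j _ => (hqm' i j).const_mul _]
        refine Finset.sum_congr rfl fun j _ => ?_
        rw [lintegral_const_mul _ (hqm' i j)]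
        congr 1
        exact lintegral_lintegral_update (hqm i j) i
    _ ≤ 2 * ENNReal.ofReal (copiesSup k F) + S +
          ∑ j, (k j * ENNReal.ofReal (P j) + k j * ENNReal.ofReal ε) := by
        gcongr
        rw [Finset.sum_comm]
        refine Finset.sum_le_sum fun j _ => ?_
        rw [← Finset.mul_sum, ← mul_add, ← ENNReal.ofReal_add (hP j) hε.le, mul_comm]
        gcongr
        exact hcol j
    _ ≤ 2 * ENNReal.ofReal (copiesSup k F) + S +
          ((∑ i, ∑ j, ENNReal.ofReal (P j) * ((cubeMeasure m).prod (Measure.pi fun j => F i j))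
            {z | z.2 ∈ favSet (P + ε • z.1) j}) + ∑ j, k j * ENNReal.ofReal ε) := by
        rw [Finset.sum_add_distrib, Finset.sum_comm (s := (Finset.univ : Finset (Fin n)))]
        gcongr with j
        exact hclear j
    _ = 2 * ENNReal.ofReal (copiesSup k F) +
          ((∑ i, ∑ j, ENNReal.ofReal (P j) * ((cubeMeasure m).prod (Measure.pi fun j => F i j))
            {z | z.2 ∈ favSet (P + ε • z.1) j}) + S) + ∑ j, k j * ENNReal.ofReal ε := by ring
    _ ≤ 2 * ENNReal.ofReal (copiesSup k F) + 2 * ENNReal.ofReal (copiesSup k F) +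
          ∑ j, k j * ENNReal.ofReal ε := by gcongr
    _ = _ := by ring

end LotteryRevenue

/-- For `n` unit-demand agents, `m` items with capacities
`k j ≥ 1`, and independent values `v i j ∼ F i j` (Borel distributions on
`ℝ≥0` with finite mean), the expected revenue of every lottery-based mechanism
for the multi-agent instance is at most `5` times the supremum of expected
revenue over IC, IR deterministic mechanisms for the copies instance. -/
theorem lotteryMech_le_five_copiesSup
    {n m : ℕ} (k : Fin m → ℕ) (hk : ∀ j, 1 ≤ k j)
    (F : Fin n → Fin m → Measure ℝ) [∀ i j, IsProbabilityMeasure (F i j)]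
    (hF_nonneg : ∀ i j, F i j (Set.Iio 0) = 0)
    (hF_mean : ∀ i j, Integrable id (F i j))
    (menu : Fin n → (Fin n → Fin m → ℝ) → Set (Lottery m))
    (q : (Fin n → Fin m → ℝ) → Fin n → Fin m → ℝ)
    (p : (Fin n → Fin m → ℝ) → Fin n → ℝ)
    (hmech : IsLotteryMech n m k menu q p) :
    lotteryMechRevenue F p ≤
      5 * sSup {r : ℝ | ∃ (X : (Fin n → Fin m → ℝ) → Finset (Fin n × Fin m))
        (pay : (Fin n → Fin m → ℝ) → Fin n × Fin m → ℝ),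
        IsCopiesMech n m k X pay ∧ r = copiesRevenue F pay} := by
  change _ ≤ 5 * copiesSup k F
  have hopt : 0 ≤ copiesSup k F := copiesSup_nonneg
  have hbound : ∑ i, ∫⁻ v, ENNReal.ofReal (p v i) ∂(valMeasure F) ≤
      4 * ENNReal.ofReal (copiesSup k F) := by
    have hlim : Filter.Tendsto
        (fun ε : ℝ => 4 * ENNReal.ofReal (copiesSup k F) + ∑ j, k j * ENNReal.ofReal ε)
        (nhdsWithin 0 (Set.Ioi 0)) (nhds (4 * ENNReal.ofReal (copiesSup k F) +
          ∑ j, k j * ENNReal.ofReal 0)) := by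
      refine Filter.Tendsto.mono_left (Continuous.tendsto ?_ 0) nhdsWithin_le_nhds
      exact continuous_const.add (continuous_finsetSum _ fun j _ =>
        (ENNReal.continuous_const_mul (ENNReal.natCast_ne_top _)).comp ENNReal.continuous_ofReal)
    simp only [ENNReal.ofReal_zero, mul_zero, Finset.sum_const_zero, add_zero] at hlim
    refine ge_of_tendsto hlim ?_
    filter_upwards [self_mem_nhdsWithin] with ε hε
    exact hmech.sum_lintegral_price_le hk hF_nonneg hF_mean hε
  have hnonneg : ∀ᵐ v ∂(valMeasure F), ∀ i, 0 ≤ p v i := by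
    filter_upwards [ae_nonneg_valMeasure hF_nonneg] with v hv i using hmech.p_nonneg hv i
  have hlint : ∫⁻ v, ENNReal.ofReal (∑ i, p v i) ∂(valMeasure F) =
      ∑ i, ∫⁻ v, ENNReal.ofReal (p v i) ∂(valMeasure F) := by
    rw [← lintegral_finsetSum _ fun i _ => (hmech.measP i).ennreal_ofReal]
    refine lintegral_congr_ae ?_
    filter_upwards [hnonneg] with v hv using ENNReal.ofReal_sum_of_nonneg fun i _ => hv i
  rw [lotteryMechRevenue, integral_eq_lintegral_of_nonneg_ae
    (hnonneg.mono fun v hv => Finset.sum_nonneg fun i _ => hv i)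
    (Finset.measurable_sum _ fun i _ => hmech.measP i).aestronglyMeasurable, hlint]
  refine (ENNReal.toReal_mono (by finiteness) hbound).trans ?_
  rw [ENNReal.toReal_mul, ENNReal.toReal_ofReal hopt]
  norm_num
  linarith
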